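/- Let H be a graph that is 3-connected or isomorphic to K_3, and let q > r ≥ 2 be integers. Then for every graph F that is r-Ramsey-minimal for H there are infinitely many graphs G that are q-Ramsey-minimal for H and contain F as an induced subgraph; that is, for every natural number N there exists a graph G on more than N vertices such that G is q-Ramsey-minimal for H and G contains an induced subgraph isomorphic to F. -/

import Mathlib

open SimpleGraph

/-- The colouring `c` contains a copy of `H` in `G` all of whose edges have colour `i`. -/
def HasMonoCopyColor {V W : Type*} (G : SimpleGraph V) (H : SimpleGraph W) {q : ℕ}
    (c : Sym2 V → Fin q) (i : Fin q) : Prop :=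
  ∃ f : W ↪ V, ∀ a b, H.Adj a b → G.Adj (f a) (f b) ∧ c s(f a, f b) = i

/-- The colouring `c` contains a monochromatic copy of `H` in `G`. -/
def HasMonoCopy {V W : Type*} (G : SimpleGraph V) (H : SimpleGraph W) {q : ℕ}
    (c : Sym2 V → Fin q) : Prop :=
  ∃ i : Fin q, HasMonoCopyColor G H c i

/-- `G` is `q`-Ramsey for `H`: every `q`-colouring of the edges of `G` contains a
monochromatic copy of `H`. -/
def IsRamsey (q : ℕ) {V W : Type*} (G : SimpleGraph V) (H : SimpleGraph W) : Prop :=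
  ∀ c : Sym2 V → Fin q, HasMonoCopy G H c

/-- `G` is `q`-Ramsey-minimal for `H`: `G` is `q`-Ramsey for `H` but no proper
subgraph of `G` is. -/
def IsRamseyMinimal (q : ℕ) {V W : Type*} (G : SimpleGraph V) (H : SimpleGraph W) : Prop :=
  IsRamsey q G H ∧ ∀ G' : G.Subgraph, G' ≠ ⊤ → ¬ IsRamsey q G'.coe H

/-- `H` is 3-connected: it has at least 4 vertices and deleting any set of at most
2 vertices leaves a connected graph. -/
def ThreeConnected {V : Type*} [Fintype V] (H : SimpleGraph V) : Prop :=
  4 ≤ Fintype.card V ∧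
    ∀ S : Finset V, S.card ≤ 2 → (H.induce ((↑S : Set V)ᶜ)).Connected

/-- `H` is 3-connected or isomorphic to `K₃`. -/
def ThreeConnOrK3 {V : Type*} [Fintype V] (H : SimpleGraph V) : Prop :=
  ThreeConnected H ∨ Nonempty (H ≃g (⊤ : SimpleGraph (Fin 3)))

/-- Every nonempty family of at most `g` edges of the uniform hypergraph `e` has a member that
meets the union of the others in at most one vertex. -/
def LocallyForest {I K Y : Type} (g : ℕ) (e : I → K → Y) : Prop :=
  ∀ J : Finset I, J.Nonempty → J.card ≤ g → ∃ j ∈ J, ∀ a b : K,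
    (∃ i ∈ J, i ≠ j ∧ e j a ∈ Set.range (e i)) →
    (∃ i ∈ J, i ≠ j ∧ e j b ∈ Set.range (e i)) → a = b

/-- In a locally forest-like hypergraph a leaf can be chosen so as to stay a leaf after marking
one further vertex. -/
lemma LocallyForest.exists_leaf {I K Y : Type} {g : ℕ} {e : I → K → Y}
    (he : LocallyForest g e) (inj : ∀ i, Function.Injective (e i)) :
    ∀ (n : ℕ) (J : Finset I), J.card = n → J.Nonempty → J.card ≤ g →
      ∀ Z : Set Y, Z.Subsingleton → ∃ j ∈ J, ∀ a b : K,
        ((∃ i ∈ J, i ≠ j ∧ e j a ∈ Set.range (e i)) ∨ e j a ∈ Z) →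
        ((∃ i ∈ J, i ≠ j ∧ e j b ∈ Set.range (e i)) ∨ e j b ∈ Z) → a = b := by
  classical
  intro n
  induction n with
  | zero =>
    intro J hJ hne
    exact absurd (Finset.card_eq_zero.mp hJ) hne.ne_empty
  | succ n ih =>
    intro J hJ hne hg Z hZ
    obtain ⟨j, hj, hleaf⟩ := he J hne hg
    by_contra hcon
    have hno := hcon
    push Not at hcon
    obtain ⟨a, b, ha, hb, hab⟩ := hcon j hj
    have hJ2 : (J.erase j).card = n := by rw [Finset.card_erase_of_mem hj, hJ]; rfl
    have hZZ : ∀ x y, e j x ∈ Z → e j y ∈ Z → x = y := fun x y hx hy => inj j (hZ hx hy)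
    obtain ⟨x, y, hx, hy, hxy⟩ : ∃ x y, e j x ∈ Z ∧
        (∃ i ∈ J, i ≠ j ∧ e j y ∈ Set.range (e i)) ∧ x ≠ y := by
      rcases ha with ha | ha <;> rcases hb with hb | hb
      · exact absurd (hleaf a b ha hb) hab
      · exact ⟨b, a, hb, ha, Ne.symm hab⟩
      · exact ⟨a, b, ha, hb, hab⟩
      · exact absurd (hZZ a b ha hb) hab
    have hne2 : (J.erase j).Nonempty := by
      obtain ⟨i, hi, hij, -⟩ := hy
      exact ⟨i, Finset.mem_erase.mpr ⟨hij, hi⟩⟩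
    obtain ⟨j₂, hj₂, hleaf₂⟩ := ih (J.erase j) hJ2 hne2
      ((Finset.card_le_card (Finset.erase_subset _ _)).trans hg)
      {z | ∃ c, e j c = z ∧ ∃ i ∈ J, i ≠ j ∧ e j c ∈ Set.range (e i)} (by
        rintro _ ⟨c, rfl, hc⟩ _ ⟨d, rfl, hd⟩
        rw [hleaf c d hc hd])
    obtain ⟨hj₂j, hj₂J⟩ := Finset.mem_erase.mp hj₂
    refine hno ⟨j₂, hj₂J, fun c d hc hd => ?_⟩
    have conv : ∀ c, ((∃ i ∈ J, i ≠ j₂ ∧ e j₂ c ∈ Set.range (e i)) ∨ e j₂ c ∈ Z) →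
        ((∃ i ∈ J.erase j, i ≠ j₂ ∧ e j₂ c ∈ Set.range (e i)) ∨
          e j₂ c ∈ {z | ∃ c, e j c = z ∧ ∃ i ∈ J, i ≠ j ∧ e j c ∈ Set.range (e i)}) := by
      rintro c (⟨i, hi, hij, hr⟩ | hc)
      · by_cases h : i = j
        · subst h
          obtain ⟨c', hc'⟩ := hr
          exact Or.inr ⟨c', hc', j₂, hj₂J, hj₂j, hc' ▸ ⟨c, rfl⟩⟩
        · exact Or.inl ⟨i, Finset.mem_erase.mpr ⟨h, hi⟩, hij, hr⟩
      · have hcx : e j₂ c = e j x := hZ hc hx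
        exact absurd (hleaf x y ⟨j₂, hj₂J, hj₂j, c, hcx⟩ hy) hxy
    exact hleaf₂ c d (conv c hc) (conv d hd)

/-- A locally forest-like hypergraph remains so when its edges are pulled apart. -/
lemma LocallyForest.of_factor {I K Y Y' : Type} {g : ℕ} {e : I → K → Y} (he : LocallyForest g e)
    {e' : I → K → Y'} (f : Y' → Y) (hf : ∀ i k, f (e' i k) = e i k) : LocallyForest g e' := by
  intro J hJ hg
  obtain ⟨j, hj, h⟩ := he J hJ hg
  have conv : ∀ a, (∃ i ∈ J, i ≠ j ∧ e' j a ∈ Set.range (e' i)) →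
      ∃ i ∈ J, i ≠ j ∧ e j a ∈ Set.range (e i) := by
    rintro a ⟨i, hi, hij, b, hb⟩
    exact ⟨i, hi, hij, b, by rw [← hf, hb, hf]⟩
  exact ⟨j, hj, fun a b ha hb => h a b (conv a ha) (conv b hb)⟩

lemma LocallyForest.comp_injective {I I' K Y : Type} {g : ℕ} {e : I → K → Y}
    (he : LocallyForest g e) (f : I' → I) (hf : Function.Injective f) :
    LocallyForest g (fun i => e (f i)) := by
  classical
  intro J hJ hg
  obtain ⟨y, hy, h⟩ := he (J.image f) (hJ.image f) (Finset.card_image_le.trans hg)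
  obtain ⟨j, hj, rfl⟩ := Finset.mem_image.mp hy
  have conv : ∀ a, (∃ i ∈ J, i ≠ j ∧ e (f j) a ∈ Set.range (e (f i))) →
      ∃ i ∈ J.image f, i ≠ f j ∧ e (f j) a ∈ Set.range (e i) := by
    rintro a ⟨i, hi, hij, hr⟩
    exact ⟨f i, Finset.mem_image_of_mem f hi, fun h => hij (hf h), hr⟩
  exact ⟨j, hj, fun a b ha hb => h a b (conv a ha) (conv b hb)⟩

lemma LocallyForest.eq_of_two_common {I K Y : Type} {g : ℕ} {e : I → K → Y}
    (he : LocallyForest g e) (inj : ∀ i, Function.Injective (e i)) (hg : 2 ≤ g) {i j : I}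
    {a b a' b' : K} (ha : e i a = e j a') (hb : e i b = e j b') (hab : a ≠ b) : i = j := by
  classical
  by_contra hij
  obtain ⟨l, hl, h⟩ := he {i, j} ⟨i, by simp⟩ (by rw [Finset.card_pair hij]; exact hg)
  rcases Finset.mem_insert.mp hl with rfl | hl
  · exact hab (h a b ⟨j, by simp, Ne.symm hij, a', ha.symm⟩ ⟨j, by simp, Ne.symm hij, b', hb.symm⟩)
  · obtain rfl := Finset.mem_singleton.mp hl
    have := h a' b' ⟨i, by simp, hij, a, ha⟩ ⟨i, by simp, hij, b, hb⟩
    subst this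
    exact hab (inj i (ha.trans hb.symm))

/-- One step of the partite amalgamation: copies of a partite hypergraph are glued along the part
`α` according to a locally forest-like hypergraph `m` of large chromatic number. -/
lemma LocallyForest.amalgam {A I K V M Y : Type} {g : ℕ} (hg : 1 ≤ g) (α : A) {p : V → A}
    {e : I → K → V} (hp : ∀ i, Function.Injective (fun k => p (e i k)))
    (he : LocallyForest (g + 1) e) {m : M → {v // p v = α} → Y}
    (hminj : ∀ i, Function.Injective (m i)) (hm : LocallyForest g m)
    {e' : M × I → K → Y ⊕ (M × V)}
    (he₁ : ∀ x i k (h : p (e i k) = α), e' (x, i) k = Sum.inl (m x ⟨e i k, h⟩))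
    (he₂ : ∀ x i k, p (e i k) ≠ α → e' (x, i) k = Sum.inr (x, e i k)) :
    LocallyForest (g + 1) e' := by
  classical
  have hinj : ∀ i, Function.Injective (e i) := fun i a b h => hp i (congrArg p h)
  have overlap : ∀ x i k x' i' k', e' (x, i) k = e' (x', i') k' →
      (x = x' ∧ e i k = e i' k') ∨
      (x ≠ x' ∧ ∃ (h : p (e i k) = α) (h' : p (e i' k') = α),
        m x ⟨e i k, h⟩ = m x' ⟨e i' k', h'⟩) := by
    intro x i k x' i' k' h
    by_cases hk : p (e i k) = α <;> by_cases hk' : p (e i' k') = α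
    · rw [he₁ _ _ _ hk, he₁ _ _ _ hk'] at h
      have h := Sum.inl.inj h
      by_cases hx : x = x'
      · subst hx
        exact Or.inl ⟨rfl, congrArg Subtype.val (hminj x h)⟩
      · exact Or.inr ⟨hx, hk, hk', h⟩
    · rw [he₁ _ _ _ hk, he₂ _ _ _ hk'] at h
      cases h
    · rw [he₂ _ _ _ hk, he₁ _ _ _ hk'] at h
      cases h
    · rw [he₂ _ _ _ hk, he₂ _ _ _ hk'] at h
      have h := Sum.inr.inj h
      exact Or.inl ⟨congrArg Prod.fst h, congrArg Prod.snd h⟩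
  intro J hJ hJg
  set fib : M → Finset (M × I) := fun x => J.filter (fun y => y.1 = x) with hfib
  by_cases hcase : ∃ x, (fib x).card = 1
  · obtain ⟨x, hx⟩ := hcase
    obtain ⟨⟨x', j⟩, hxj⟩ := Finset.card_eq_one.mp hx
    have hmem : (x', j) ∈ fib x := by rw [hxj]; simp
    obtain ⟨hmemJ, hx'⟩ := Finset.mem_filter.mp hmem
    dsimp only at hx'
    subst hx'
    have conv : ∀ a, (∃ i ∈ J, i ≠ (x', j) ∧ e' (x', j) a ∈ Set.range (e' i)) →
        p (e j a) = α := by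
      rintro a ⟨⟨y, i⟩, hi, hne, b, hb⟩
      rcases overlap _ _ _ _ _ _ hb with ⟨rfl, -⟩ | ⟨-, -, h, -⟩
      · have : (y, i) ∈ fib y := Finset.mem_filter.mpr ⟨hi, rfl⟩
        rw [hxj] at this
        exact absurd (Finset.mem_singleton.mp this) hne
      · exact h
    exact ⟨(x', j), hmemJ, fun a b ha hb => hp j ((conv a ha).trans (conv b hb).symm)⟩
  · push Not at hcase
    have hfib2 : ∀ x ∈ J.image Prod.fst, 2 ≤ (fib x).card := by
      intro x hx
      obtain ⟨y, hy, rfl⟩ := Finset.mem_image.mp hx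
      have : 0 < (fib y.1).card := Finset.card_pos.mpr ⟨y, Finset.mem_filter.mpr ⟨hy, rfl⟩⟩
      have := hcase y.1
      omega
    have hsum : (J.image Prod.fst).card * 2 ≤ J.card := by
      rw [Finset.card_eq_sum_card_image Prod.fst J]
      simpa using Finset.card_nsmul_le_sum _ _ 2 hfib2
    obtain ⟨x, hx, hleaf⟩ := hm (J.image Prod.fst) (hJ.image _) (by omega)
    obtain ⟨⟨x', i₀⟩, hi₀, hx'⟩ := Finset.mem_image.mp hx
    dsimp only at hx'
    subst hx'
    obtain ⟨j, hj, hjleaf⟩ := he.exists_leaf hinj _ ((fib x').image Prod.snd) rfl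
      ⟨i₀, Finset.mem_image.mpr ⟨(x', i₀), Finset.mem_filter.mpr ⟨hi₀, rfl⟩, rfl⟩⟩
      ((Finset.card_image_le.trans (Finset.card_filter_le _ _)).trans hJg)
      {v | ∃ h : p v = α, ∃ y ∈ J.image Prod.fst, y ≠ x' ∧ m x' ⟨v, h⟩ ∈ Set.range (m y)} (by
        rintro v ⟨h, hv⟩ w ⟨h', hw⟩
        exact congrArg Subtype.val (hleaf _ _ hv hw))
    obtain ⟨⟨x, j'⟩, hxj, rfl⟩ := Finset.mem_image.mp hj
    obtain ⟨hxJ, hx2⟩ := Finset.mem_filter.mp hxj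
    dsimp only at hx2
    subst hx2
    have conv : ∀ a, (∃ i ∈ J, i ≠ (x, j') ∧ e' (x, j') a ∈ Set.range (e' i)) →
        ((∃ i ∈ (fib x).image Prod.snd, i ≠ j' ∧ e j' a ∈ Set.range (e i)) ∨
          e j' a ∈ {v | ∃ h : p v = α, ∃ y ∈ J.image Prod.fst, y ≠ x ∧
            m x ⟨v, h⟩ ∈ Set.range (m y)}) := by
      rintro a ⟨⟨y, i⟩, hi, hne, b, hb⟩
      rcases overlap _ _ _ _ _ _ hb with ⟨rfl, h⟩ | ⟨hyx, h, h', hh⟩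
      · refine Or.inl ⟨i, Finset.mem_image.mpr ⟨(y, i), Finset.mem_filter.mpr ⟨hi, rfl⟩, rfl⟩,
          fun h => hne (by rw [h]), b, h⟩
      · exact Or.inr ⟨h', y, Finset.mem_image.mpr ⟨(y, i), hi, rfl⟩, hyx, _, hh⟩
    exact ⟨(x, j'), hxJ, fun a b ha hb => hjleaf a b (conv a ha) (conv b hb)⟩

/-- For every `q` and `g` there are finite uniform hypergraphs, of any finite uniformity, which
have no proper `q`-colouring and whose small edge families are forests. -/
theorem exists_locallyForest_not_colorable {q : ℕ} (hq : 0 < q) (g : ℕ) :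
    ∀ (K : Type) [Finite K], ∃ (Y I : Type) (_ : Finite Y) (_ : Finite I) (e : I → K → Y),
      (∀ i, Function.Injective (e i)) ∧ LocallyForest (g + 1) e ∧
      ∀ c : Y → Fin q, ∃ i, ∀ a b, c (e i a) = c (e i b) := by
  classical
  induction g with
  | zero =>
    intro K _
    have := Fintype.ofFinite K
    refine ⟨Fin (q * Fintype.card K + 1), K ↪ Fin (q * Fintype.card K + 1), inferInstance,
      inferInstance, fun i k => i k, fun i => i.injective, ?_, ?_⟩
    · intro J hJ hg
      obtain ⟨j, hj⟩ := hJ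
      refine ⟨j, hj, ?_⟩
      rintro a b ⟨i, hi, hij, -⟩
      exact absurd (Finset.card_le_one.mp (by simpa using hg) i hi j hj) hij
    · intro c
      obtain ⟨y, hy⟩ := Fintype.exists_lt_card_fiber_of_mul_lt_card c (n := Fintype.card K)
        (by simp)
      obtain ⟨i⟩ : Nonempty (K ↪ {x // c x = y}) := Function.Embedding.nonempty_of_card_le (by
        rw [Fintype.card_subtype]; exact hy.le)
      exact ⟨i.trans (Function.Embedding.subtype _), fun a b => (i a).2.trans (i b).2.symm⟩
  | succ g ih =>
    intro K _
    have := Fintype.ofFinite K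
    have stage : ∀ B : Finset (Fin (q * Fintype.card K + 1)),
        ∃ (V I : Type) (_ : Finite V) (_ : Finite I) (p : V → Fin (q * Fintype.card K + 1))
          (e : I → K → V), (∀ i, Function.Injective (fun k => p (e i k))) ∧
          LocallyForest (g + 2) e ∧
          ∀ c : V → Fin q, ∃ χ : Fin (q * Fintype.card K + 1) → Fin q,
            ∀ κ : K ↪ Fin (q * Fintype.card K + 1), ∃ i, (∀ k, p (e i k) = κ k) ∧
              ∀ k, κ k ∈ B → c (e i k) = χ (κ k) := by
      intro B
      induction B using Finset.induction with
      | empty =>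
        refine ⟨(K ↪ Fin (q * Fintype.card K + 1)) × K, K ↪ Fin (q * Fintype.card K + 1),
          inferInstance, inferInstance, fun x => x.1 x.2, fun κ k => (κ, k),
          fun κ => κ.injective, ?_, ?_⟩
        · intro J hJ _
          obtain ⟨j, hj⟩ := hJ
          refine ⟨j, hj, ?_⟩
          rintro a b ⟨i, hi, hij, k, hk⟩
          exact absurd (congrArg Prod.fst hk) hij
        · intro c
          exact ⟨fun _ => ⟨0, hq⟩, fun κ => ⟨κ, fun _ => rfl, by simp⟩⟩
      | insert α B hα ihB =>
        obtain ⟨V, I, _, _, p, e, hp, he, hc⟩ := ihB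
        obtain ⟨Y, M, _, _, m, hminj, hm, hmc⟩ := ih {v // p v = α}
        set e' : M × I → K → Y ⊕ (M × V) := fun x k =>
          if h : p (e x.2 k) = α then Sum.inl (m x.1 ⟨e x.2 k, h⟩) else Sum.inr (x.1, e x.2 k)
        have he₁ : ∀ x i k (h : p (e i k) = α), e' (x, i) k = Sum.inl (m x ⟨e i k, h⟩) :=
          fun x i k h => dif_pos h
        have he₂ : ∀ x i k, p (e i k) ≠ α → e' (x, i) k = Sum.inr (x, e i k) :=
          fun x i k h => dif_neg h
        have hp' : ∀ x i k, Sum.elim (fun _ => α) (fun y => p y.2) (e' (x, i) k) = p (e i k) := by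
          intro x i k
          by_cases h : p (e i k) = α
          · rw [he₁ x i k h, h]; rfl
          · rw [he₂ x i k h]; rfl
        refine ⟨Y ⊕ (M × V), M × I, inferInstance, inferInstance,
          Sum.elim (fun _ => α) (fun y => p y.2), e', ?_,
          LocallyForest.amalgam (by omega) α hp he hminj hm he₁ he₂, ?_⟩
        · rintro ⟨x, i⟩ a b hab
          refine hp i ?_
          simpa only [hp'] using hab
        · intro c
          obtain ⟨x, hx⟩ := hmc (fun y => c (Sum.inl y))
          obtain ⟨γ, hγ⟩ : ∃ γ, ∀ a, c (Sum.inl (m x a)) = γ := by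
            by_cases hne : Nonempty {v // p v = α}
            · exact ⟨_, fun a => hx a hne.some⟩
            · exact ⟨⟨0, hq⟩, fun a => absurd ⟨a⟩ hne⟩
          obtain ⟨χ, hχ⟩ := hc (fun v =>
            if h : p v = α then c (Sum.inl (m x ⟨v, h⟩)) else c (Sum.inr (x, v)))
          refine ⟨Function.update χ α γ, fun κ => ?_⟩
          obtain ⟨i, hi, hi'⟩ := hχ κ
          refine ⟨(x, i), fun k => (hp' x i k).trans (hi k), fun k hk => ?_⟩
          by_cases h : κ k = α
          · rw [h, Function.update_self, he₁ x i k ((hi k).trans h), hγ]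
          · rw [Function.update_of_ne h, ← hi' k (Finset.mem_of_mem_insert_of_ne hk h),
              he₂ x i k (by rwa [hi k]), dif_neg (by rwa [hi k])]
    obtain ⟨V, I, hV, hI, p, e, hp, he, hc⟩ := stage Finset.univ
    refine ⟨V, I, hV, hI, e, fun i a b h => hp i (congrArg p h), he, fun c => ?_⟩
    obtain ⟨χ, hχ⟩ := hc c
    obtain ⟨y, hy⟩ := Fintype.exists_lt_card_fiber_of_mul_lt_card χ (n := Fintype.card K)
      (by simp)
    obtain ⟨κ⟩ : Nonempty (K ↪ {x // χ x = y}) := Function.Embedding.nonempty_of_card_le (by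
      rw [Fintype.card_subtype]; exact hy.le)
    obtain ⟨i, -, hi⟩ := hχ (κ.trans (Function.Embedding.subtype _))
    have hi : ∀ k, c (e i k) = y := fun k => (hi k (Finset.mem_univ _)).trans (κ k).2
    exact ⟨i, fun a b => (hi a).trans (hi b).symm⟩

/-- `H` has at least three vertices and deleting any at most two of them leaves a connected
graph. -/
def TwoSeparatorFree {W : Type} [Fintype W] (H : SimpleGraph W) : Prop :=
  3 ≤ Fintype.card W ∧ ∀ S : Finset W, S.card ≤ 2 → (H.induce ((↑S : Set W)ᶜ)).Connected

lemma ThreeConnOrK3.twoSeparatorFree {W : Type} [Fintype W] {H : SimpleGraph W}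
    (hH : ThreeConnOrK3 H) : TwoSeparatorFree H := by
  classical
  rcases hH with ⟨h4, h⟩ | ⟨⟨φ⟩⟩
  · exact ⟨by omega, h⟩
  · have hcard : Fintype.card W = 3 := by simpa using Fintype.card_congr φ.toEquiv
    refine ⟨hcard.ge, fun S hS => ?_⟩
    obtain ⟨w, hw⟩ : ∃ w, w ∉ S := by
      by_contra hcon
      push Not at hcon
      have : S = Finset.univ := Finset.eq_univ_iff_forall.mpr hcon
      rw [this, Finset.card_univ] at hS
      omega
    have : Nonempty ↑((↑S : Set W)ᶜ) := ⟨⟨w, by simpa using hw⟩⟩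
    refine ⟨fun a b => ?_⟩
    by_cases hab : a = b
    · rw [hab]
    · refine SimpleGraph.Adj.reachable ?_
      change H.Adj a b
      rw [← φ.map_adj_iff, SimpleGraph.top_adj]
      exact fun h => hab (Subtype.ext (φ.injective h))

/-- A property which is inherited along edges avoiding a set of at most two vertices holds
everywhere outside this set as soon as it holds somewhere. -/
lemma TwoSeparatorFree.propagate {W : Type} [Fintype W] {H : SimpleGraph W}
    (hH : TwoSeparatorFree H) {S : Finset W} (hS : S.card ≤ 2) {A : W → Prop}
    (hA : ∀ a b, a ∉ S → b ∉ S → H.Adj a b → A a → A b) {a : W} (ha : a ∉ S) (hAa : A a) :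
    ∀ b, b ∉ S → A b := by
  intro b hb
  obtain ⟨w⟩ := (hH.2 S hS).preconnected ⟨a, by simpa using ha⟩ ⟨b, by simpa using hb⟩
  have key : ∀ (x y : ↑((↑S : Set W)ᶜ)), (H.induce ((↑S : Set W)ᶜ)).Walk x y → A x → A y := by
    intro x y w
    induction w with
    | nil => exact id
    | @cons u v _ h _ ih =>
      intro hu
      exact ih (hA u v (fun h => u.2 h) (fun h => v.2 h) h hu)
  exact key _ _ w hAa

lemma TwoSeparatorFree.exists_adj_ne {W : Type} [Fintype W] {H : SimpleGraph W}
    (hH : TwoSeparatorFree H) (a d : W) : ∃ b, H.Adj a b ∧ b ≠ d := by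
  classical
  by_contra hcon
  push Not at hcon
  have h := hH.propagate (S := ({d} : Finset W).erase a)
    ((Finset.card_le_card (Finset.erase_subset _ _)).trans (by simp)) (A := fun b => b = a)
    (by
      rintro _ b - hb hab rfl
      have := hcon b hab
      subst this
      by_contra hne
      exact hb (by simp [hne])) (a := a) (by simp) rfl
  have hsub : (Finset.univ : Finset W) ⊆ {a, d} := by
    intro b _
    by_cases hbd : b = d
    · simp [hbd]
    · simp [h b (by simp [hbd])]
  have := (Finset.card_le_card hsub).trans Finset.card_le_two
  rw [Finset.card_univ] at this
  have := hH.1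
  omega

lemma TwoSeparatorFree.connected {W : Type} [Fintype W] {H : SimpleGraph W}
    (hH : TwoSeparatorFree H) (a b : W) : ∃ w : H.Walk a b, w.length < Fintype.card W := by
  classical
  obtain ⟨w⟩ : H.Reachable a b := hH.propagate (S := ∅) (by simp) (A := fun b => H.Reachable a b)
    (fun x y _ _ hxy hx => hx.trans hxy.reachable) (a := a) (by simp)
    (SimpleGraph.Reachable.refl a) b (by simp)
  exact ⟨w.toPath, w.toPath.2.length_lt⟩

lemma HasMonoCopy.of_embedding {V V' W : Type} {G : SimpleGraph V} {G' : SimpleGraph V'}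
    {H : SimpleGraph W} {q : ℕ} {c : Sym2 V → Fin q} {c' : Sym2 V' → Fin q} (φ : V ↪ V')
    (hadj : ∀ a b, G.Adj a b → G'.Adj (φ a) (φ b))
    (hcol : ∀ a b, G.Adj a b → c' s(φ a, φ b) = c s(a, b)) (h : HasMonoCopy G H c) :
    HasMonoCopy G' H c' := by
  obtain ⟨i, f, hf⟩ := h
  exact ⟨i, f.trans φ, fun a b hab => ⟨hadj _ _ (hf a b hab).1,
    (hcol _ _ (hf a b hab).1).trans (hf a b hab).2⟩⟩

/-- A monochromatic copy inside the image of an embedded piece is one in the piece. -/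
lemma HasMonoCopy.of_forall_mem_range {V V' W : Type} {G : SimpleGraph V} {G' : SimpleGraph V'}
    {H : SimpleGraph W} {q : ℕ} {c : Sym2 V → Fin q} {c' : Sym2 V' → Fin q} (φ : V → V')
    (f : W ↪ V') {i : Fin q} (hf : ∀ a b, H.Adj a b → G'.Adj (f a) (f b) ∧ c' s(f a, f b) = i)
    (hr : ∀ a, f a ∈ Set.range φ)
    (hadj : ∀ a b, G'.Adj (φ a) (φ b) → G.Adj a b ∧ c' s(φ a, φ b) = c s(a, b)) :
    HasMonoCopy G H c := by
  choose g hg using hr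
  refine ⟨i, ⟨g, fun a b hab => f.injective (by rw [← hg a, ← hg b, hab])⟩, fun a b hab => ?_⟩
  obtain ⟨h1, h2⟩ := hf a b hab
  rw [← hg a, ← hg b] at h1 h2
  obtain ⟨h3, h4⟩ := hadj _ _ h1
  exact ⟨h3, h4.symm.trans h2⟩

lemma IsRamsey.of_embedding {V V' W : Type} {G : SimpleGraph V} {G' : SimpleGraph V'}
    {H : SimpleGraph W} {q : ℕ} (φ : V ↪ V') (hadj : ∀ a b, G.Adj a b → G'.Adj (φ a) (φ b))
    (h : IsRamsey q G H) : IsRamsey q G' H :=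
  fun c => (h (fun z => c (z.map φ))).of_embedding φ hadj fun _ _ _ => rfl

lemma hasMonoCopy_comp_iff {V W : Type} {G : SimpleGraph V} {H : SimpleGraph W} {q : ℕ}
    {c : Sym2 V → Fin q} (σ : Equiv.Perm (Fin q)) :
    HasMonoCopy G H (fun z => σ (c z)) ↔ HasMonoCopy G H c := by
  constructor
  · rintro ⟨i, f, hf⟩
    exact ⟨σ.symm i, f, fun a b hab => ⟨(hf a b hab).1, by rw [← (hf a b hab).2]; simp⟩⟩
  · rintro ⟨i, f, hf⟩
    exact ⟨σ i, f, fun a b hab => ⟨(hf a b hab).1, congrArg σ (hf a b hab).2⟩⟩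

/-- Long sequences in which the colour of a pair depends only on its first member. -/
lemma exists_end_homogeneous {q : ℕ} (l : ℕ) : ∃ n : ℕ, ∀ (V : Type) [DecidableEq V]
    (c : Sym2 V → Fin q) (S : Finset V), n ≤ S.card →
      ∃ (f : Fin l ↪ V) (χ : Fin l → Fin q), (∀ i, f i ∈ S) ∧
        ∀ i j, i < j → c s(f i, f j) = χ i := by
  induction l with
  | zero =>
    exact ⟨0, fun V _ c S _ => ⟨⟨Fin.elim0, fun i => i.elim0⟩, Fin.elim0, fun i => i.elim0,
      fun i => i.elim0⟩⟩
  | succ l ih =>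
    obtain ⟨n, hn⟩ := ih
    refine ⟨q * n + 2, fun V _ c S hS => ?_⟩
    obtain ⟨v, hv⟩ : S.Nonempty := Finset.card_pos.mp (by omega)
    obtain ⟨γ, -, hγ⟩ := Finset.exists_lt_card_fiber_of_mul_lt_card_of_maps_to
      (s := S.erase v) (t := (Finset.univ : Finset (Fin q))) (f := fun w => c s(v, w)) (n := n)
      (fun _ _ => Finset.mem_univ _) (by
        rw [Finset.card_univ, Fintype.card_fin, Finset.card_erase_of_mem hv]; omega)
    obtain ⟨f, χ, hf, hχ⟩ := hn V c _ hγ.le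
    have hf' : ∀ i, (f i ≠ v ∧ f i ∈ S) ∧ c s(v, f i) = γ := fun i => by
      simpa using hf i
    refine ⟨⟨Fin.cons v f, ?_⟩, Fin.cons γ χ, ?_, ?_⟩
    · rw [Fin.cons_injective_iff]
      exact ⟨fun ⟨i, hi⟩ => (hf' i).1.1 hi, f.injective⟩
    · intro i
      refine Fin.cases hv (fun i => (hf' i).1.2) i
    · intro i j
      refine Fin.cases ?_ (fun i => ?_) i <;> refine Fin.cases ?_ (fun j => ?_) j
      · intro h; exact absurd h (lt_irrefl _)
      · intro _; exact (hf' j).2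
      · intro h; exact absurd h (Fin.not_lt_zero _)
      · intro h; exact hχ i j (Fin.succ_lt_succ_iff.mp h)

/-- Ramsey's theorem. -/
theorem exists_isRamsey {W : Type} [Fintype W] (H : SimpleGraph W) (q : ℕ) :
    ∃ n : ℕ, IsRamsey q (⊤ : SimpleGraph (Fin n)) H := by
  classical
  obtain ⟨n, hn⟩ := exists_end_homogeneous (q := q) (q * Fintype.card W + 1)
  refine ⟨n, fun c => ?_⟩
  obtain ⟨f, χ, -, hχ⟩ := hn (Fin n) c Finset.univ (by simp)
  obtain ⟨γ, hγ⟩ := Fintype.exists_lt_card_fiber_of_mul_lt_card χ (n := Fintype.card W) (by simp)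
  obtain ⟨κ⟩ : Nonempty (W ↪ {x // χ x = γ}) := Function.Embedding.nonempty_of_card_le (by
    rw [Fintype.card_subtype]; exact hγ.le)
  refine ⟨γ, (κ.trans (Function.Embedding.subtype _)).trans f, fun a b hab => ⟨?_, ?_⟩⟩
  · rw [SimpleGraph.top_adj]
    exact fun h => hab.ne (((κ.trans (Function.Embedding.subtype _)).trans f).injective h)
  · have hne : (κ a).1 ≠ (κ b).1 := fun h => hab.ne (κ.injective (Subtype.ext h))
    rcases lt_or_gt_of_ne hne with h | h
    · exact (hχ _ _ h).trans (κ a).2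
    · rw [Sym2.eq_swap]
      exact (hχ _ _ h).trans (κ b).2

/-- Copies `ι i` of a graph `P` glued at a common vertex `o = ι i v` and along the neighbours
`k x` of `v` according to a hypergraph `e` with locally forest-like structure; every vertex of the
hypergraph is moreover joined to `o`. -/
structure StarGluing {I K Y V U : Type} (g : ℕ) (P : SimpleGraph V) (v : V) (k : K → V)
    (e : I → K → Y) (ι : I → V → U) (o : U) (τ : Y → U) (Γ : SimpleGraph U) : Prop where
  adj_k : ∀ x, P.Adj v (k x)
  e_injective : ∀ i, Function.Injective (e i)
  forest : LocallyForest g e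
  two_le : 2 ≤ g
  map_v : ∀ i, ι i v = o
  map_k : ∀ i x, ι i (k x) = τ (e i x)
  τ_injective : Function.Injective τ
  τ_ne : ∀ y, τ y ≠ o
  exists_k : ∀ i p y, ι i p = τ y → ∃ x, p = k x
  overlap : ∀ i p j p', ι i p = ι j p' → (i = j ∧ p = p') ∨ (p = v ∧ p' = v) ∨
    ∃ x x', p = k x ∧ p' = k x' ∧ e i x = e j x'
  adj_iff : ∀ u w, Γ.Adj u w ↔ (∃ i p p', P.Adj p p' ∧ ι i p = u ∧ ι i p' = w) ∨
    (∃ y, o = u ∧ τ y = w) ∨ (∃ y, τ y = u ∧ o = w)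

namespace StarGluing

variable {I K Y V U : Type} {g : ℕ} {P : SimpleGraph V} {v : V} {k : K → V}
  {e : I → K → Y} {ι : I → V → U} {o : U} {τ : Y → U} {Γ : SimpleGraph U}

lemma injective (h : StarGluing g P v k e ι o τ Γ) (i : I) : Function.Injective (ι i) := by
  intro p p' hp
  rcases h.overlap _ _ _ _ hp with ⟨-, h1⟩ | ⟨h1, h2⟩ | ⟨x, x', h1, h2, h3⟩
  · exact h1
  · rw [h1, h2]
  · rw [h1, h2, h.e_injective i h3]

lemma eq_v (h : StarGluing g P v k e ι o τ Γ) {i : I} {p : V} (hp : ι i p = o) : p = v :=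
  h.injective i (hp.trans (h.map_v i).symm)

lemma adj_of_adj_o (h : StarGluing g P v k e ι o τ Γ) {i : I} {p : V} (hp : Γ.Adj o (ι i p)) :
    P.Adj v p := by
  rcases (h.adj_iff _ _).mp hp with ⟨j, p₁, p₂, h1, h2, h3⟩ | ⟨y, -, h3⟩ | ⟨y, h2, -⟩
  · obtain rfl := h.eq_v h2
    rcases h.overlap _ _ _ _ h3 with ⟨-, h4⟩ | ⟨h4, -⟩ | ⟨x, x', -, h4, -⟩
    · rwa [← h4]
    · rw [h4] at h1; exact absurd h1 P.irrefl
    · rw [h4]; exact h.adj_k x'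
  · obtain ⟨x, rfl⟩ := h.exists_k _ _ _ h3.symm
    exact h.adj_k x
  · exact absurd h2 (h.τ_ne y)

/-- An edge of the glued graph which avoids `o` and has both ends in the piece `i`
is an edge of this piece. -/
lemma adj_of_adj (h : StarGluing g P v k e ι o τ Γ) {i : I} {p p' : V}
    (hp : Γ.Adj (ι i p) (ι i p')) : P.Adj p p' := by
  by_cases hpv : p = v
  · subst hpv
    rw [h.map_v] at hp
    exact h.adj_of_adj_o hp
  by_cases hpv' : p' = v
  · subst hpv'
    rw [h.map_v] at hp
    exact (h.adj_of_adj_o hp.symm).symm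
  rcases (h.adj_iff _ _).mp hp with ⟨j, p₁, p₂, h1, h2, h3⟩ | ⟨y, h2, -⟩ | ⟨y, -, h3⟩
  · rcases h.overlap _ _ _ _ h2 with ⟨hij, h4⟩ | ⟨-, h4⟩ | ⟨x, x', h4, h5, h6⟩
    · subst hij
      rwa [← h4, ← h.injective _ h3]
    · exact absurd h4 hpv
    · rcases h.overlap _ _ _ _ h3 with ⟨hij, h7⟩ | ⟨-, h7⟩ | ⟨z, z', h7, h8, h9⟩
      · subst hij
        rwa [← h7, ← h.injective _ h2]
      · exact absurd h7 hpv'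
      · have hxz : x ≠ z := fun hxz => h1.ne (by rw [h4, h7, hxz])
        obtain rfl := h.forest.eq_of_two_common h.e_injective h.two_le h6 h9 hxz
        rwa [← h.injective _ h2, ← h.injective _ h3]
  · exact absurd (h.eq_v h2.symm) hpv
  · exact absurd (h.eq_v h3.symm) (by assumption)

/-- A copy of `H` in the glued graph lies inside one of the pieces. -/
lemma exists_forall_mem_range {W : Type} [Fintype W] {H : SimpleGraph W}
    (hH : TwoSeparatorFree H)
    (h : StarGluing (Fintype.card W * Fintype.card W) P v k e ι o τ Γ) (f : W ↪ U)
    (hf : ∀ a b, H.Adj a b → Γ.Adj (f a) (f b)) : ∃ i, ∀ a, f a ∈ Set.range (ι i) := by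
  classical
  let E := {x : W × W // H.Adj x.1 x.2 ∧ f x.1 ≠ o ∧ f x.2 ≠ o}
  have hpc : ∀ x : E, ∃ i, f x.1.1 ∈ Set.range (ι i) ∧ f x.1.2 ∈ Set.range (ι i) := by
    rintro ⟨⟨a, b⟩, hab, ha, hb⟩
    rcases (h.adj_iff _ _).mp (hf _ _ hab) with ⟨i, p, p', -, h2, h3⟩ | ⟨y, h2, -⟩ | ⟨y, -, h3⟩
    · exact ⟨i, ⟨p, h2⟩, ⟨p', h3⟩⟩
    · exact absurd h2.symm ha
    · exact absurd h3.symm hb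
  choose pc hpc₁ hpc₂ using hpc
  obtain ⟨S₀, hS₀, hcard₀⟩ : ∃ S₀ : Finset W, (∀ a, a ∈ S₀ ↔ f a = o) ∧ S₀.card ≤ 1 := by
    refine ⟨Finset.univ.filter fun a => f a = o, by simp, Finset.card_le_one.mpr ?_⟩
    intro a ha b hb
    simp only [Finset.mem_filter, Finset.mem_univ, true_and] at ha hb
    exact f.injective (ha.trans hb.symm)
  have hnbr : ∀ a, f a ≠ o → ∃ b, H.Adj a b ∧ f b ≠ o := by
    intro a ha
    by_cases hd : ∃ d, f d = o
    · obtain ⟨d, hd⟩ := hd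
      obtain ⟨b, hab, hb⟩ := hH.exists_adj_ne a d
      exact ⟨b, hab, fun hb' => hb (f.injective (hb'.trans hd.symm))⟩
    · push Not at hd
      obtain ⟨b, hab, -⟩ := hH.exists_adj_ne a a
      exact ⟨b, hab, hd b⟩
  have hW : ∃ a, f a ≠ o := by
    by_contra hcon
    push Not at hcon
    have h1 : S₀ = Finset.univ := Finset.eq_univ_iff_forall.mpr fun a => (hS₀ a).mpr (hcon a)
    rw [h1, Finset.card_univ] at hcard₀
    have := hH.1
    omega
  let J : Finset I := Finset.univ.image pc
  have hJ : J.Nonempty := by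
    obtain ⟨a, ha⟩ := hW
    obtain ⟨b, hab, hb⟩ := hnbr a ha
    exact ⟨_, Finset.mem_image_of_mem pc (Finset.mem_univ (⟨(a, b), hab, ha, hb⟩ : E))⟩
  have hJcard : J.card ≤ Fintype.card W * Fintype.card W := by
    refine Finset.card_image_le.trans ?_
    rw [Finset.card_univ, ← Fintype.card_prod]
    exact Fintype.card_le_of_injective (fun x : E => x.1) Subtype.val_injective
  obtain ⟨j, hjJ, hj⟩ := h.forest J hJ hJcard
  obtain ⟨x₀, -, hx₀⟩ := Finset.mem_image.mp hjJ
  let inc : I → W → Prop := fun i a => ∃ x : E, pc x = i ∧ (x.1.1 = a ∨ x.1.2 = a)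
  have inc_mem : ∀ {i a}, inc i a → f a ∈ Set.range (ι i) := by
    rintro i a ⟨x, rfl, rfl | rfl⟩
    · exact hpc₁ x
    · exact hpc₂ x
  have inc_J : ∀ {i a}, inc i a → i ∈ J := by
    rintro i a ⟨x, rfl, -⟩
    exact Finset.mem_image_of_mem pc (Finset.mem_univ x)
  have inc_ne : ∀ {i a}, inc i a → f a ≠ o := by
    rintro i a ⟨x, rfl, rfl | rfl⟩
    · exact x.2.2.1
    · exact x.2.2.2
  let S₁ : Finset W := Finset.univ.filter fun a => inc j a ∧ ∃ i, i ≠ j ∧ inc i a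
  have hcard₁ : S₁.card ≤ 1 := by
    have key : ∀ a ∈ S₁, ∃ x, f a = ι j (k x) ∧
        ∃ i ∈ J, i ≠ j ∧ e j x ∈ Set.range (e i) := by
      intro a ha
      obtain ⟨h1, i, hij, h2⟩ := (Finset.mem_filter.mp ha).2
      obtain ⟨p, hp⟩ := inc_mem h1
      obtain ⟨p', hp'⟩ := inc_mem h2
      rcases h.overlap _ _ _ _ (hp.trans hp'.symm) with ⟨h3, -⟩ | ⟨h3, -⟩ | ⟨x, x', h3, -, h5⟩
      · exact absurd h3.symm hij
      · rw [h3, h.map_v] at hp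
        exact absurd hp.symm (inc_ne h1)
      · exact ⟨x, by rw [← hp, h3], i, inc_J h2, hij, x', h5.symm⟩
    refine Finset.card_le_one.mpr fun a ha b hb => ?_
    obtain ⟨x, hx, hx'⟩ := key a ha
    obtain ⟨y, hy, hy'⟩ := key b hb
    exact f.injective (by rw [hx, hy, hj x y hx' hy'])
  have hS : (S₀ ∪ S₁).card ≤ 2 := (Finset.card_union_le _ _).trans (by omega)
  have hstep : ∀ a b, a ∉ S₀ ∪ S₁ → b ∉ S₀ → H.Adj a b → inc j a →
      inc j b ∧ ∀ hx, pc ⟨(a, b), hx⟩ = j := by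
    intro a b ha hb hab hja
    simp only [Finset.mem_union, not_or] at ha
    have hE : H.Adj a b ∧ f a ≠ o ∧ f b ≠ o :=
      ⟨hab, fun h' => ha.1 ((hS₀ a).mpr h'), fun h' => hb ((hS₀ b).mpr h')⟩
    have hpj : pc ⟨(a, b), hE⟩ = j := by
      by_contra hne
      exact ha.2 (Finset.mem_filter.mpr ⟨Finset.mem_univ _, hja, _, hne, ⟨(a, b), hE⟩, rfl,
        Or.inl rfl⟩)
    exact ⟨⟨⟨(a, b), hE⟩, hpj, Or.inr rfl⟩, fun _ => hpj⟩
  obtain ⟨a₀, ha₀, hja₀⟩ : ∃ a, a ∉ S₀ ∪ S₁ ∧ inc j a := by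
    have h1 : inc j x₀.1.1 := ⟨x₀, hx₀, Or.inl rfl⟩
    have h2 : inc j x₀.1.2 := ⟨x₀, hx₀, Or.inr rfl⟩
    have h3 : x₀.1.1 ∉ S₁ ∨ x₀.1.2 ∉ S₁ := by
      by_contra hcon
      push Not at hcon
      exact x₀.2.1.ne (Finset.card_le_one.mp hcard₁ _ hcon.1 _ hcon.2)
    rcases h3 with h3 | h3
    · exact ⟨_, by simp [hS₀, inc_ne h1, h3], h1⟩
    · exact ⟨_, by simp [hS₀, inc_ne h2, h3], h2⟩
  have hall : ∀ b, b ∉ S₀ ∪ S₁ → inc j b :=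
    hH.propagate hS (A := inc j)
      (fun a b ha hb hab hja => (hstep a b ha (fun h' => hb (by simp [h'])) hab hja).1) ha₀ hja₀
  refine ⟨j, fun a => ?_⟩
  by_cases ha : f a = o
  · exact ⟨v, by rw [ha, h.map_v]⟩
  by_cases ha₁ : a ∈ S₁
  · exact inc_mem (Finset.mem_filter.mp ha₁).2.1
  · exact inc_mem (hall a (by simp [hS₀, ha, ha₁]))

end StarGluing

lemma exists_forall_eq_of_functional {A B : Type} [Nonempty B] (r : A → B → Prop)
    (hr : ∀ a b b', r a b → r a b' → b = b') : ∃ c : A → B, ∀ a b, r a b → c a = b := by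
  classical
  refine ⟨fun a => if h : ∃ b, r a b then h.choose else Classical.arbitrary B, fun a b hab => ?_⟩
  have h : ∃ b, r a b := ⟨b, hab⟩
  simp only [dif_pos h]
  exact hr _ _ _ h.choose_spec hab

/-- The relation `R` on `K`-indexed families of colours describes exactly the possible colourings
of certain edges `s(v, k x)` at a vertex `v` of some finite graph in colourings without
monochromatic copies of `H`. -/
def Realizable {W : Type} (H : SimpleGraph W) (q : ℕ) (K : Type) (R : (K → Fin q) → Prop) : Prop :=
  ∃ (V : Type) (_ : Finite V) (P : SimpleGraph V) (v : V) (k : K → V), Function.Injective k ∧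
    (∀ x, P.Adj v (k x)) ∧
    ∀ t : K → Fin q, R t ↔ ∃ c : Sym2 V → Fin q, ¬ HasMonoCopy P H c ∧ ∀ x, c s(v, k x) = t x

lemma StarGluing.exists_colouring_iff {I K Y V U : Type} {P : SimpleGraph V} {v : V} {k : K → V}
    {e : I → K → Y} {ι : I → V → U} {o : U} {τ : Y → U} {Γ : SimpleGraph U} {W : Type} [Fintype W]
    {H : SimpleGraph W} (hH : TwoSeparatorFree H) {q : ℕ} (hq : 0 < q)
    (h : StarGluing (Fintype.card W * Fintype.card W) P v k e ι o τ Γ) (t : Y → Fin q) :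
    (∃ c : Sym2 U → Fin q, ¬ HasMonoCopy Γ H c ∧ ∀ y, c s(o, τ y) = t y) ↔
      ∀ i, ∃ c : Sym2 V → Fin q, ¬ HasMonoCopy P H c ∧ ∀ x, c s(v, k x) = t (e i x) := by
  constructor
  · rintro ⟨c, hc, hct⟩ i
    refine ⟨fun z => c (z.map (ι i)), fun hm => hc ?_, fun x => ?_⟩
    · exact hm.of_embedding ⟨ι i, h.injective i⟩
        (fun a b hab => (h.adj_iff _ _).mpr (Or.inl ⟨i, a, b, hab, rfl, rfl⟩)) fun _ _ _ => rfl
    · change c s(ι i v, ι i (k x)) = _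
      rw [h.map_v, h.map_k, hct]
  · intro hi
    choose c hc hct using hi
    have : Nonempty (Fin q) := ⟨⟨0, hq⟩⟩
    have compat : ∀ i j p p' r r', P.Adj p p' → P.Adj r r' → ι i p = ι j r → ι i p' = ι j r' →
        c i s(p, p') = c j s(r, r') := by
      intro i j p p' r r' hp hr h1 h2
      by_cases hij : i = j
      · subst hij
        rw [h.injective i h1, h.injective i h2]
      rcases h.overlap _ _ _ _ h1 with ⟨h3, -⟩ | ⟨rfl, rfl⟩ | ⟨x, x', rfl, rfl, hx⟩
      · exact absurd h3 hij
      · rcases h.overlap _ _ _ _ h2 with ⟨h3, -⟩ | ⟨h3, -⟩ | ⟨x, x', rfl, rfl, hx⟩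
        · exact absurd h3 hij
        · exact absurd h3.symm hp.ne
        · rw [hct, hct, hx]
      · rcases h.overlap _ _ _ _ h2 with ⟨h3, -⟩ | ⟨rfl, rfl⟩ | ⟨z, z', rfl, rfl, hz⟩
        · exact absurd h3 hij
        · rw [Sym2.eq_swap, hct, Sym2.eq_swap, hct, hx]
        · exact absurd (h.forest.eq_of_two_common h.e_injective h.two_le hx hz
            (fun hxz => hp.ne (by rw [hxz]))) hij
    have compat' : ∀ i p p' y, ι i p = o → ι i p' = τ y → c i s(p, p') = t y := by
      intro i p p' y h1 h2
      obtain ⟨x, rfl⟩ := h.exists_k _ _ _ h2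
      rw [h.eq_v h1, hct]
      rw [h.map_k] at h2
      rw [h.τ_injective h2]
    obtain ⟨C, hC⟩ := exists_forall_eq_of_functional (A := Sym2 U) (B := Fin q)
      (fun z γ => (∃ i p p', P.Adj p p' ∧ s(ι i p, ι i p') = z ∧ c i s(p, p') = γ) ∨
        ∃ y, s(o, τ y) = z ∧ t y = γ) (by
      rintro z γ γ' (⟨i, p, p', hp, h1, rfl⟩ | ⟨y, h1, rfl⟩) (⟨j, r, r', hr, h2, rfl⟩ | ⟨y', h2, rfl⟩)
      · rw [← h2, Sym2.eq_iff] at h1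
        rcases h1 with ⟨h1, h2⟩ | ⟨h1, h2⟩
        · exact compat _ _ _ _ _ _ hp hr h1 h2
        · rw [Sym2.eq_swap (a := r)]
          exact compat _ _ _ _ _ _ hp hr.symm h1 h2
      · rw [← h2, Sym2.eq_iff] at h1
        rcases h1 with ⟨h1, h2⟩ | ⟨h1, h2⟩
        · exact compat' _ _ _ _ h1 h2
        · rw [Sym2.eq_swap]
          exact compat' _ _ _ _ h2 h1
      · rw [← h1, Sym2.eq_iff] at h2
        rcases h2 with ⟨h1, h2⟩ | ⟨h1, h2⟩
        · exact (compat' _ _ _ _ h1 h2).symm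
        · rw [Sym2.eq_swap]
          exact (compat' _ _ _ _ h2 h1).symm
      · rw [← h2, Sym2.eq_iff] at h1
        rcases h1 with ⟨-, h1⟩ | ⟨h1, -⟩
        · rw [h.τ_injective h1]
        · exact absurd h1.symm (h.τ_ne _))
    refine ⟨C, ?_, fun y => hC _ _ (Or.inr ⟨y, rfl, rfl⟩)⟩
    rintro ⟨γ, f, hf⟩
    obtain ⟨i, hi⟩ := h.exists_forall_mem_range hH f fun a b hab => (hf a b hab).1
    refine hc i (HasMonoCopy.of_forall_mem_range (ι i) f hf hi fun a b hab => ?_)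
    have hab' := h.adj_of_adj hab
    exact ⟨hab', hC _ _ (Or.inl ⟨i, a, b, hab', rfl, rfl⟩)⟩

lemma Realizable.glue {I K Y W : Type} [Fintype W] [Finite I] [Finite Y] {H : SimpleGraph W}
    (hH : TwoSeparatorFree H) {q : ℕ} (hq : 0 < q) {R : (K → Fin q) → Prop}
    (hR : Realizable H q K R) {e : I → K → Y} (inj : ∀ i, Function.Injective (e i))
    (he : LocallyForest (Fintype.card W * Fintype.card W) e) :
    Realizable H q Y (fun t => ∀ i, R (fun x => t (e i x))) := by
  classical
  obtain ⟨V, _, P, v, k, hk, hvk, hR⟩ := hR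
  let ι : I → V → Option (Y ⊕ (I × V)) := fun i p => if p = v then none else
    if h : ∃ x, k x = p then some (Sum.inl (e i h.choose)) else some (Sum.inr (i, p))
  have ι_v : ∀ i, ι i v = none := fun i => if_pos rfl
  have ι_k : ∀ i x, ι i (k x) = some (Sum.inl (e i x)) := by
    intro i x
    have h : ∃ x', k x' = k x := ⟨x, rfl⟩
    simp only [ι, if_neg (hvk x).ne', dif_pos h]
    rw [hk h.choose_spec]
  have cases : ∀ p, p = v ∨ (∃ x, p = k x) ∨ ∀ i, ι i p = some (Sum.inr (i, p)) := by
    intro p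
    by_cases hp : p = v
    · exact Or.inl hp
    by_cases hx : ∃ x, k x = p
    · obtain ⟨x, rfl⟩ := hx
      exact Or.inr (Or.inl ⟨x, rfl⟩)
    · exact Or.inr (Or.inr fun i => by simp only [ι, if_neg hp, dif_neg hx])
  have overlap : ∀ i p j p', ι i p = ι j p' → (i = j ∧ p = p') ∨ (p = v ∧ p' = v) ∨
      ∃ x x', p = k x ∧ p' = k x' ∧ e i x = e j x' := by
    intro i p j p' h
    rcases cases p with rfl | ⟨x, rfl⟩ | hp <;> rcases cases p' with rfl | ⟨x', rfl⟩ | hp'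
    · simp
    · simp [ι_v, ι_k] at h
    · simp [ι_v, hp'] at h
    · simp [ι_v, ι_k] at h
    · simp only [ι_k, Option.some.injEq, Sum.inl.injEq] at h
      exact Or.inr (Or.inr ⟨x, x', rfl, rfl, h⟩)
    · simp [ι_k, hp'] at h
    · simp [ι_v, hp] at h
    · simp [ι_k, hp] at h
    · simp only [hp, hp', Option.some.injEq, Sum.inr.injEq, Prod.mk.injEq] at h
      exact Or.inl h
  have ι_inj : ∀ i, Function.Injective (ι i) := by
    intro i p p' hp
    rcases overlap _ _ _ _ hp with ⟨-, h1⟩ | ⟨h1, h2⟩ | ⟨x, x', h1, h2, h3⟩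
    · exact h1
    · rw [h1, h2]
    · rw [h1, h2, inj i h3]
  let Γ : SimpleGraph (Option (Y ⊕ (I × V))) :=
    { Adj := fun u w => (∃ i p p', P.Adj p p' ∧ ι i p = u ∧ ι i p' = w) ∨
        (∃ y : Y, none = u ∧ some (Sum.inl y) = w) ∨ (∃ y : Y, some (Sum.inl y) = u ∧ none = w)
      symm := ⟨by
        rintro u w (⟨i, p, p', h, h1, h2⟩ | ⟨y, h1, h2⟩ | ⟨y, h1, h2⟩)
        · exact Or.inl ⟨i, p', p, h.symm, h2, h1⟩
        · exact Or.inr (Or.inr ⟨y, h2, h1⟩)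
        · exact Or.inr (Or.inl ⟨y, h2, h1⟩)⟩
      loopless := ⟨by
        rintro u (⟨i, p, p', h, h1, h2⟩ | ⟨y, h1, h2⟩ | ⟨y, h1, h2⟩)
        · exact h.ne (ι_inj i (h1.trans h2.symm))
        · simp [← h1] at h2
        · simp [← h2] at h1⟩ }
  have hΓ : StarGluing (Fintype.card W * Fintype.card W) P v k e ι none
      (fun y => some (Sum.inl y)) Γ :=
    { adj_k := hvk
      e_injective := inj
      forest := he
      two_le := by nlinarith [hH.1]
      map_v := ι_v
      map_k := ι_k
      τ_injective := fun y y' h => by simpa using h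
      τ_ne := fun y => by simp
      exists_k := by
        intro i p y h
        rcases cases p with rfl | hx | hp
        · simp [ι_v] at h
        · exact hx
        · simp [hp] at h
      overlap := overlap
      adj_iff := fun u w => Iff.rfl }
  refine ⟨_, inferInstance, Γ, none, fun y => some (Sum.inl y), hΓ.τ_injective,
    fun y => Or.inr (Or.inl ⟨y, rfl, rfl⟩), fun t => ?_⟩
  rw [hΓ.exists_colouring_iff hH hq t]
  exact forall_congr' fun i => hR _

lemma Realizable.project {K Y W : Type} {H : SimpleGraph W} {q : ℕ} {R : (Y → Fin q) → Prop}
    (hR : Realizable H q Y R) (σ : K → Y) (hσ : Function.Injective σ) :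
    Realizable H q K (fun s => ∃ t, R t ∧ ∀ x, t (σ x) = s x) := by
  obtain ⟨V, _, P, v, k, hk, hvk, hR⟩ := hR
  refine ⟨V, inferInstance, P, v, fun x => k (σ x), hk.comp hσ, fun x => hvk _, fun s => ?_⟩
  constructor
  · rintro ⟨t, ht, hts⟩
    obtain ⟨c, hc, hct⟩ := (hR t).mp ht
    exact ⟨c, hc, fun x => by rw [hct, hts]⟩
  · rintro ⟨c, hc, hcs⟩
    exact ⟨fun y => c s(v, k y), (hR _).mpr ⟨c, hc, fun _ => rfl⟩, hcs⟩

lemma Realizable.comp_perm {K W : Type} {H : SimpleGraph W} {q : ℕ} {R : (K → Fin q) → Prop}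
    (hR : Realizable H q K R) (σ : Equiv.Perm (Fin q)) {t : K → Fin q} (ht : R t) :
    R (fun x => σ (t x)) := by
  obtain ⟨V, _, P, v, k, hk, hvk, hR⟩ := hR
  obtain ⟨c, hc, hct⟩ := (hR t).mp ht
  exact (hR _).mpr ⟨fun z => σ (c z), fun h => hc ((hasMonoCopy_comp_iff σ).mp h),
    fun x => congrArg σ (hct x)⟩

lemma TwoSeparatorFree.exists_adj {W : Type} [Fintype W] {H : SimpleGraph W}
    (hH : TwoSeparatorFree H) : ∃ a b, H.Adj a b := by
  obtain ⟨a⟩ : Nonempty W := Fintype.card_pos_iff.mp (by have := hH.1; omega)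
  obtain ⟨b, hab, -⟩ := hH.exists_adj_ne a a
  exact ⟨a, b, hab⟩

lemma IsRamsey.exists_minimal_le {V W : Type} [Finite V] {G : SimpleGraph V} {H : SimpleGraph W}
    {q : ℕ} (h : IsRamsey q G H) :
    ∃ G' ≤ G, IsRamsey q G' H ∧ ∀ G'' < G', ¬ IsRamsey q G'' H := by
  obtain ⟨G', hle, hG'⟩ :=
    exists_minimal_le_of_wellFoundedLT (fun G' : SimpleGraph V => IsRamsey q G' H) G h
  exact ⟨G', hle, hG'.prop, fun G'' hlt h'' => hG'.not_prop_of_lt hlt h''⟩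

lemma exists_realizable_nonconstant {W : Type} [Fintype W] {H : SimpleGraph W}
    (hH : TwoSeparatorFree H) {q : ℕ} (hq : 2 ≤ q) :
    ∃ (K : Type) (_ : Finite K) (R : (K → Fin q) → Prop), Realizable H q K R ∧ (∃ t, R t) ∧
      ∀ t, R t → ∀ γ, ∃ x, t x ≠ γ := by
  classical
  obtain ⟨n, hn⟩ := exists_isRamsey H q
  obtain ⟨G, -, hG, hmin⟩ := hn.exists_minimal_le
  obtain ⟨a, b, hab⟩ := hH.exists_adj
  obtain ⟨_, f, hf⟩ := hG fun _ => ⟨0, by omega⟩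
  set v := f a
  set x := f b
  have hvx : G.Adj v x := (hf a b hab).1
  let P := G.deleteEdges {s(v, x)}
  have hPG : ∀ u w, P.Adj u w ↔ G.Adj u w ∧ s(u, w) ≠ s(v, x) := by
    intro u w
    simp only [P, SimpleGraph.deleteEdges_adj, Set.mem_singleton_iff, ne_eq]
  have hlt : P < G := by
    refine lt_of_le_of_ne (SimpleGraph.deleteEdges_le _) fun h => ?_
    rw [← h, hPG] at hvx
    exact hvx.2 rfl
  obtain ⟨c₀, hc₀⟩ := not_forall.mp (hmin P hlt)
  refine ⟨{y // P.Adj v y}, inferInstance,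
    fun t => ∃ c : Sym2 (Fin n) → Fin q, ¬ HasMonoCopy P H c ∧ ∀ y : {y // P.Adj v y},
      c s(v, y) = t y,
    ⟨Fin n, inferInstance, P, v, Subtype.val, Subtype.val_injective, fun y => y.2,
      fun t => Iff.rfl⟩, ⟨_, c₀, hc₀, fun y => rfl⟩, ?_⟩
  rintro t ⟨c, hc, hct⟩ γ
  by_contra hcon
  push Not at hcon
  have hcv : ∀ y, P.Adj v y → c s(v, y) = γ := fun y hy => (hct ⟨y, hy⟩).trans (hcon _)
  obtain ⟨γ', hγ'⟩ : ∃ γ' : Fin q, γ' ≠ γ := by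
    have : Nontrivial (Fin q) := Fin.nontrivial_iff_two_le.mpr hq
    exact exists_ne γ
  obtain ⟨i, f', hf'⟩ := hG (Function.update c s(v, x) γ')
  have hno : ∀ a b, H.Adj a b → f' a = v → f' b ≠ x := by
    intro a b hab ha hb
    obtain ⟨b', hab', hbb'⟩ := hH.exists_adj_ne a b
    have h1 := (hf' a b hab).2
    rw [ha, hb, Function.update_self] at h1
    obtain ⟨h2, h3⟩ := hf' a b' hab'
    rw [ha] at h2 h3
    have hne : s(v, f' b') ≠ s(v, x) := by
      intro h
      rw [Sym2.congr_right] at h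
      exact hbb' (f'.injective (h.trans hb.symm))
    rw [Function.update_of_ne hne, hcv _ ((hPG _ _).mpr ⟨h2, hne⟩), ← h1] at h3
    exact hγ' h3.symm
  refine hc ⟨i, f', fun a b hab => ?_⟩
  obtain ⟨h1, h2⟩ := hf' a b hab
  have hne : s(f' a, f' b) ≠ s(v, x) := by
    intro h
    rcases Sym2.eq_iff.mp h with ⟨h3, h4⟩ | ⟨h3, h4⟩
    · exact hno a b hab h3 h4
    · exact hno b a hab.symm h4 h3
  rw [Function.update_of_ne hne] at h2
  exact ⟨(hPG _ _).mpr ⟨h1, hne⟩, h2⟩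

/-- A gadget forcing two edges to have different colours. -/
theorem realizable_ne {W : Type} [Fintype W] {H : SimpleGraph W} (hH : TwoSeparatorFree H) {q : ℕ}
    (hq : 2 ≤ q) : Realizable H q Bool (fun t => t false ≠ t true) := by
  classical
  obtain ⟨K, _, R, hR, ⟨t₀, ht₀⟩, hnc⟩ := exists_realizable_nonconstant hH hq
  obtain ⟨Y, I, _, _, e, inj, he, hcol⟩ := exists_locallyForest_not_colorable (q := q) (by omega)
    (Fintype.card W * Fintype.card W) K
  have he' : LocallyForest (Fintype.card W * Fintype.card W) e :=
    fun J hJ hJc => he J hJ (by omega)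
  let ok : Setoid (I × K) → Prop := fun s => s ≤ Setoid.ker (fun p : I × K => e p.1 p.2) ∧
    ∃ t : I × K → Fin q, (∀ p p', s p p' → t p = t p') ∧ ∀ i, R fun x => t (i, x)
  have : Finite (Setoid (I × K)) :=
    Finite.of_injective (fun s : Setoid (I × K) => s.r) fun s s' h => Setoid.ext fun a b => by
      exact iff_of_eq (congrFun (congrFun h a) b)
  obtain ⟨s, hs⟩ : ∃ s, Maximal ok s := by
    obtain ⟨s, -, hs⟩ := exists_maximal_ge_of_wellFoundedGT ok ⊥
      ⟨bot_le, fun p => t₀ p.2, fun p p' h => by rw [h], fun i => ht₀⟩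
    exact ⟨s, hs⟩
  obtain ⟨hsle, t₁, ht₁, ht₁R⟩ := hs.prop
  have hsne : ¬ Setoid.ker (fun p : I × K => e p.1 p.2) ≤ s := by
    intro hle
    obtain ⟨C, hC⟩ := exists_forall_eq_of_functional (A := Y) (B := Option (Fin q))
      (fun y γ => ∃ p : I × K, e p.1 p.2 = y ∧ some (t₁ p) = γ) (by
        rintro y γ γ' ⟨p, hp, rfl⟩ ⟨p', hp', rfl⟩
        rw [ht₁ p p' (hle (hp.trans hp'.symm))])
    obtain ⟨i, hi⟩ := hcol fun y => (C y).getD ⟨0, by omega⟩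
    have hi' : ∀ a b, t₁ (i, a) = t₁ (i, b) := by
      intro a b
      have := hi a b
      rwa [hC _ _ ⟨(i, a), rfl, rfl⟩, hC _ _ ⟨(i, b), rfl, rfl⟩] at this
    obtain ⟨x, hx⟩ := hnc _ (ht₁R i) ⟨0, by omega⟩
    obtain ⟨z, hz⟩ := hnc _ (ht₁R i) (t₁ (i, x))
    exact hz (hi' z x)
  obtain ⟨p₁, p₂, hker, hns⟩ : ∃ p₁ p₂ : I × K, e p₁.1 p₁.2 = e p₂.1 p₂.2 ∧ ¬ s p₁ p₂ := by
    by_contra hcon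
    push Not at hcon
    exact hsne fun {p p'} h => hcon p p' h
  have hsep : ∀ t : I × K → Fin q, (∀ p p', s p p' → t p = t p') → (∀ i, R fun x => t (i, x)) →
      t p₁ ≠ t p₂ := by
    intro t ht htR heq
    have hle : s ≤ s ⊔ Setoid.ker t ⊓ Setoid.ker (fun p : I × K => e p.1 p.2) := le_sup_left
    have := hs.le_of_ge (y := s ⊔ Setoid.ker t ⊓ Setoid.ker (fun p : I × K => e p.1 p.2))
      ⟨sup_le hsle inf_le_right, t, fun p p' h => ?_, htR⟩ hle
    · exact hns (this ((le_sup_right : _ ≤ s ⊔ _) ⟨heq, hker⟩))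
    · have h1 : s ⊔ Setoid.ker t ⊓ Setoid.ker (fun p : I × K => e p.1 p.2) ≤ Setoid.ker t :=
        sup_le (fun {p p'} h => ht p p' h) inf_le_left
      exact h1 h
  have hfac : ∀ (i : I) (x : K), Quotient.lift (s := s) (fun p : I × K => e p.1 p.2)
      (fun p p' h => hsle h) (Quotient.mk s (i, x)) = e i x := fun i x => rfl
  have hR' := (hR.glue hH (by omega) (e := fun i x => Quotient.mk s (i, x))
    (fun i x x' h => inj i (by
      rw [← hfac i x, ← hfac i x']
      exact congrArg _ h))
    (he'.of_factor _ hfac)).project (K := Bool)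
      (fun b => bif b then Quotient.mk s p₂ else Quotient.mk s p₁) (by
        have hne : Quotient.mk s p₁ ≠ Quotient.mk s p₂ := fun h => hns (Quotient.exact h)
        intro b b'
        cases b <;> cases b' <;> simp [hne, hne.symm])
  convert hR' using 2 with u
  constructor
  · intro hu
    let t : Quotient s → Fin q := Quotient.lift t₁ ht₁
    have ht : t (Quotient.mk s p₁) ≠ t (Quotient.mk s p₂) := hsep t₁ ht₁ ht₁R
    obtain ⟨σ, hσ₁, hσ₂⟩ : ∃ σ : Equiv.Perm (Fin q), σ (t (Quotient.mk s p₁)) = u false ∧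
        σ (t (Quotient.mk s p₂)) = u true := by
      let σ₁ := Equiv.swap (t (Quotient.mk s p₁)) (u false)
      have h1 : σ₁ (t (Quotient.mk s p₁)) = u false := Equiv.swap_apply_left _ _
      have h2 : σ₁ (t (Quotient.mk s p₂)) ≠ u false := fun h => ht (σ₁.injective (h1.trans h.symm))
      refine ⟨σ₁.trans (Equiv.swap (σ₁ (t (Quotient.mk s p₂))) (u true)), ?_, ?_⟩
      · rw [Equiv.trans_apply, h1]
        exact Equiv.swap_apply_of_ne_of_ne h2.symm hu
      · rw [Equiv.trans_apply]
        exact Equiv.swap_apply_left _ _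
    refine ⟨fun y => σ (t y), fun i => hR.comp_perm σ (ht₁R i), fun b => ?_⟩
    cases b
    · exact hσ₁
    · exact hσ₂
  · rintro ⟨t, ht, htu⟩
    rw [← htu, ← htu]
    exact hsep (fun p => t (Quotient.mk s p)) (fun p p' h => congrArg t (Quotient.sound h)) ht

/-- A gadget forcing two edges to have the same colour. -/
theorem realizable_eq {W : Type} [Fintype W] {H : SimpleGraph W} (hH : TwoSeparatorFree H) {q : ℕ}
    (hq : 2 ≤ q) : Realizable H q Bool (fun t => t false = t true) := by
  classical
  obtain ⟨Y, I, _, _, e, inj, he, hcol⟩ := exists_locallyForest_not_colorable (q := q) (by omega)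
    (Fintype.card W * Fintype.card W) Bool
  have he' : LocallyForest (Fintype.card W * Fintype.card W) e :=
    fun J hJ hJc => he J hJ (by omega)
  let ok : Set I → Prop := fun J => ∃ t : Y → Fin q, ∀ i ∈ J, t (e i false) ≠ t (e i true)
  obtain ⟨J, -, hJ⟩ := exists_maximal_ge_of_wellFoundedGT ok ∅
    ⟨fun _ => ⟨0, by omega⟩, fun i hi => absurd hi (Set.notMem_empty i)⟩
  obtain ⟨t₁, ht₁⟩ := hJ.prop
  obtain ⟨i₀, hi₀⟩ : ∃ i, i ∉ J := by
    obtain ⟨i, hi⟩ := hcol t₁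
    exact ⟨i, fun h => ht₁ i h (hi _ _)⟩
  have hsep : ∀ t : Y → Fin q, (∀ i ∈ J, t (e i false) ≠ t (e i true)) →
      t (e i₀ false) = t (e i₀ true) := by
    intro t ht
    by_contra hne
    refine hi₀ (hJ.le_of_ge (y := insert i₀ J) ⟨t, fun i hi => ?_⟩ (Set.subset_insert _ _)
      (Set.mem_insert _ _))
    rcases hi with rfl | hi
    · exact hne
    · exact ht i hi
  have hR' := ((realizable_ne hH hq).glue hH (by omega) (e := fun i : J => e i.1)
    (fun i => inj i.1) (he'.comp_injective _ Subtype.val_injective)).project (e i₀) (inj i₀)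
  convert hR' using 2 with u
  constructor
  · intro hu
    refine ⟨fun y => Equiv.swap (t₁ (e i₀ false)) (u false) (t₁ y), fun i h =>
      ht₁ i.1 i.2 (Equiv.injective _ h), fun b => ?_⟩
    have : t₁ (e i₀ b) = t₁ (e i₀ false) := by
      cases b
      · rfl
      · exact (hsep t₁ ht₁).symm
    simp only [this, Equiv.swap_apply_left]
    cases b
    · rfl
    · exact hu
  · rintro ⟨t, ht, htu⟩
    rw [← htu, ← htu]
    exact hsep t fun i hi => ht ⟨i, hi⟩

/-- Gluing a gadget onto an edge of a graph. -/
lemma Realizable.exists_extension {V W : Type} [Finite V] [Fintype W] {H : SimpleGraph W}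
    (hH : TwoSeparatorFree H) {q : ℕ} (hq : 0 < q) {ρ : Fin q → Fin q → Prop}
    (hρ : Realizable H q Bool fun t => ρ (t false) (t true)) (S : SimpleGraph V) {a b : V}
    (hab : S.Adj a b) :
    ∃ (V' : Type) (_ : Finite V') (S' : SimpleGraph V') (ι : V ↪ V') (y : V'),
      y ∉ Set.range ι ∧ S'.Adj (ι b) y ∧ (∀ u w, S'.Adj (ι u) (ι w) ↔ S.Adj u w) ∧
      (∀ u w, u ∉ Set.range ι → S'.Adj u (ι w) → w = a ∨ w = b) ∧
      (∀ c' : Sym2 V' → Fin q, ¬ HasMonoCopy S' H c' →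
        ¬ HasMonoCopy S H (fun z => c' (z.map ι)) ∧ ρ (c' s(ι b, ι a)) (c' s(ι b, y))) ∧
      ∀ c : Sym2 V → Fin q, ¬ HasMonoCopy S H c → ∀ j, ρ (c s(b, a)) j →
        ∃ c' : Sym2 V' → Fin q, ¬ HasMonoCopy S' H c' ∧ (∀ u w, c' s(ι u, ι w) = c s(u, w)) ∧
          c' s(ι b, y) = j := by
  classical
  obtain ⟨V₂, _, P, v, k, hk, hvk, hR⟩ := hρ
  let κ : V₂ → V ⊕ V₂ := fun p =>
    if p = v then Sum.inl b else if p = k false then Sum.inl a else Sum.inr p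
  have κ_v : κ v = Sum.inl b := if_pos rfl
  have κ_k : κ (k false) = Sum.inl a := by
    simp only [κ, if_neg (hvk false).ne', if_true]
  have κ_other : ∀ p, p ≠ v → p ≠ k false → κ p = Sum.inr p := by
    intro p h1 h2
    simp only [κ, if_neg h1, if_neg h2]
  have κ_inl : ∀ {p s}, κ p = Sum.inl s → (p = v ∧ s = b) ∨ (p = k false ∧ s = a) := by
    intro p s h
    by_cases h1 : p = v
    · rw [h1, κ_v] at h
      exact Or.inl ⟨h1, (Sum.inl.inj h).symm⟩
    by_cases h2 : p = k false
    · rw [h2, κ_k] at h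
      exact Or.inr ⟨h2, (Sum.inl.inj h).symm⟩
    · rw [κ_other p h1 h2] at h
      cases h
  have κ_inj : Function.Injective κ := by
    intro p p' h
    by_cases h1 : p = v
    · rw [h1, κ_v] at h
      rcases κ_inl h.symm with ⟨h3, -⟩ | ⟨-, h3⟩
      · rw [h1, h3]
      · exact absurd h3 hab.ne'
    by_cases h2 : p = k false
    · rw [h2, κ_k] at h
      rcases κ_inl h.symm with ⟨-, h3⟩ | ⟨h3, -⟩
      · exact absurd h3 hab.ne
      · rw [h2, h3]
    rw [κ_other p h1 h2] at h
    by_cases h3 : p' = v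
    · rw [h3, κ_v] at h; cases h
    by_cases h4 : p' = k false
    · rw [h4, κ_k] at h; cases h
    rw [κ_other p' h3 h4] at h
    exact Sum.inr.inj h
  let S' : SimpleGraph (V ⊕ V₂) :=
    { Adj := fun u w => (∃ s t, S.Adj s t ∧ Sum.inl s = u ∧ Sum.inl t = w) ∨
        ∃ p p', P.Adj p p' ∧ κ p = u ∧ κ p' = w
      symm := ⟨by
        rintro u w (⟨s, t, h, h1, h2⟩ | ⟨p, p', h, h1, h2⟩)
        · exact Or.inl ⟨t, s, h.symm, h2, h1⟩
        · exact Or.inr ⟨p', p, h.symm, h2, h1⟩⟩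
      loopless := ⟨by
        rintro u (⟨s, t, h, h1, h2⟩ | ⟨p, p', h, h1, h2⟩)
        · exact h.ne (Sum.inl.inj (h1.trans h2.symm))
        · exact h.ne (κ_inj (h1.trans h2.symm))⟩ }
  have adj_inl : ∀ s t, S'.Adj (Sum.inl s) (Sum.inl t) ↔ S.Adj s t := by
    intro s t
    constructor
    · rintro (⟨s', t', h, h1, h2⟩ | ⟨p, p', h, h1, h2⟩)
      · rwa [← Sum.inl.inj h1, ← Sum.inl.inj h2]
      · rcases κ_inl h1 with ⟨rfl, rfl⟩ | ⟨rfl, rfl⟩ <;> rcases κ_inl h2 with ⟨rfl, rfl⟩ | ⟨rfl, rfl⟩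
        · exact absurd h P.irrefl
        · exact hab.symm
        · exact hab
        · exact absurd h P.irrefl
    · exact fun h => Or.inl ⟨s, t, h, rfl, rfl⟩
  have adj_κ : ∀ p p', S'.Adj (κ p) (κ p') → P.Adj p p' := by
    rintro p p' (⟨s', t', h, h1, h2⟩ | ⟨r, r', h, h1, h2⟩)
    · rcases κ_inl h1.symm with ⟨rfl, rfl⟩ | ⟨rfl, rfl⟩ <;>
        rcases κ_inl h2.symm with ⟨rfl, rfl⟩ | ⟨rfl, rfl⟩
      · exact absurd h S.irrefl
      · exact hvk false
      · exact (hvk false).symm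
      · exact absurd h S.irrefl
    · rwa [← κ_inj h1, ← κ_inj h2]
  have hk' : κ (k true) = Sum.inr (k true) :=
    κ_other _ (hvk true).ne' fun h => by simpa using hk h
  have hside : ∀ f : W ↪ V ⊕ V₂, (∀ x y, H.Adj x y → S'.Adj (f x) (f y)) →
      (∀ x, f x ∈ Set.range (Sum.inl : V → V ⊕ V₂)) ∨ ∀ x, f x ∈ Set.range κ := by
    intro f hf
    obtain ⟨Z, hZ, hcard⟩ : ∃ Z : Finset W, (∀ x, x ∈ Z ↔ f x = Sum.inl a ∨ f x = Sum.inl b) ∧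
        Z.card ≤ 2 := by
      refine ⟨Finset.univ.filter fun x => f x = Sum.inl a ∨ f x = Sum.inl b, by simp, ?_⟩
      refine (Finset.card_le_card_of_injOn f (t := {Sum.inl a, Sum.inl b}) ?_
        f.injective.injOn).trans Finset.card_le_two
      intro x hx
      simpa using hx
    have hcross : ∀ x y, x ∉ Z → H.Adj x y → f x ∈ Set.range (Sum.inl : V → V ⊕ V₂) →
        f y ∈ Set.range (Sum.inl : V → V ⊕ V₂) := by
      rintro x y hx hxy ⟨s, hs⟩
      rcases hf x y hxy with ⟨s', t', h, h1, h2⟩ | ⟨p, p', h, h1, h2⟩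
      · exact ⟨t', h2⟩
      · exfalso
        rw [← hs] at h1
        rcases κ_inl h1 with ⟨-, rfl⟩ | ⟨-, rfl⟩
        · exact hx ((hZ x).mpr (Or.inr hs.symm))
        · exact hx ((hZ x).mpr (Or.inl hs.symm))
    obtain ⟨x₀, hx₀⟩ : ∃ x, x ∉ Z := by
      by_contra hcon
      push Not at hcon
      rw [Finset.eq_univ_iff_forall.mpr hcon, Finset.card_univ] at hcard
      have := hH.1
      omega
    by_cases hA : f x₀ ∈ Set.range (Sum.inl : V → V ⊕ V₂)
    · left
      intro x
      by_cases hx : x ∈ Z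
      · rcases (hZ x).mp hx with h | h
        · exact ⟨a, h.symm⟩
        · exact ⟨b, h.symm⟩
      · exact hH.propagate hcard (A := fun x => f x ∈ Set.range (Sum.inl : V → V ⊕ V₂))
          (fun x y hx _ hxy => hcross x y hx hxy) hx₀ hA x hx
    · right
      intro x
      by_cases hx : x ∈ Z
      · rcases (hZ x).mp hx with h | h
        · exact ⟨k false, by rw [h, κ_k]⟩
        · exact ⟨v, by rw [h, κ_v]⟩
      · have hx' := hH.propagate hcard (A := fun x => f x ∉ Set.range (Sum.inl : V → V ⊕ V₂))
          (fun x y _ hy hxy h h' => h (hcross y x hy hxy.symm h')) hx₀ hA x hx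
        obtain ⟨y, hxy, -⟩ := hH.exists_adj_ne x x
        rcases hf x y hxy with ⟨s', t', h, h1, h2⟩ | ⟨p, p', h, h1, h2⟩
        · exact absurd ⟨s', h1⟩ hx'
        · exact ⟨p, h1⟩
  refine ⟨V ⊕ V₂, inferInstance, S', ⟨Sum.inl, Sum.inl_injective⟩, Sum.inr (k true), by simp,
    Or.inr ⟨v, k true, hvk true, κ_v, hk'⟩, adj_inl, ?_, ?_, ?_⟩
  · rintro u w hu (⟨s', t', h, h1, h2⟩ | ⟨p, p', h, h1, h2⟩)
    · exact absurd ⟨s', h1⟩ hu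
    · rcases κ_inl h2 with ⟨-, h⟩ | ⟨-, h⟩
      · exact Or.inr h
      · exact Or.inl h
  · intro c' hc'
    refine ⟨fun h => hc' (h.of_embedding ⟨Sum.inl, Sum.inl_injective⟩
      (fun s t h => (adj_inl s t).mpr h) fun _ _ _ => rfl), ?_⟩
    have h := (hR fun b => c' s(κ v, κ (k b))).mpr ⟨fun z => c' (z.map κ), fun h => hc'
      (h.of_embedding ⟨κ, κ_inj⟩ (fun p p' hp => Or.inr ⟨p, p', hp, rfl, rfl⟩) fun _ _ _ => rfl),
      fun _ => rfl⟩
    simp only [κ_v, κ_k, hk'] at h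
    exact h
  · intro c hc j hj
    obtain ⟨c₂, hc₂, hct⟩ := (hR fun x => bif x then j else c s(b, a)).mp hj
    have hct₁ : c₂ s(v, k false) = c s(b, a) := hct false
    have hct₂ : c₂ s(v, k true) = j := hct true
    have : Nonempty (Fin q) := ⟨⟨0, hq⟩⟩
    have compat : ∀ s t p p', P.Adj p p' → κ p = Sum.inl s → κ p' = Sum.inl t →
        c₂ s(p, p') = c s(s, t) := by
      intro s t p p' h h1 h2
      rcases κ_inl h1 with ⟨rfl, rfl⟩ | ⟨rfl, rfl⟩ <;> rcases κ_inl h2 with ⟨rfl, rfl⟩ | ⟨rfl, rfl⟩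
      · exact absurd h P.irrefl
      · exact hct₁
      · rw [Sym2.eq_swap, hct₁, Sym2.eq_swap]
      · exact absurd h P.irrefl
    obtain ⟨C, hC⟩ := exists_forall_eq_of_functional (A := Sym2 (V ⊕ V₂)) (B := Fin q)
      (fun z γ => (∃ s t, s(Sum.inl s, Sum.inl t) = z ∧ c s(s, t) = γ) ∨
        ∃ p p', P.Adj p p' ∧ s(κ p, κ p') = z ∧ c₂ s(p, p') = γ) (by
      rintro z γ γ' (⟨s, t, h1, rfl⟩ | ⟨p, p', hp, h1, rfl⟩)
        (⟨s', t', h2, rfl⟩ | ⟨r, r', hr, h2, rfl⟩)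
      · have := Sym2.map.injective Sum.inl_injective (a₁ := s(s, t)) (a₂ := s(s', t'))
          (h1.trans h2.symm)
        rw [this]
      · rw [← h1, Sym2.eq_iff] at h2
        rcases h2 with ⟨h2, h3⟩ | ⟨h2, h3⟩
        · exact (compat _ _ _ _ hr h2 h3).symm
        · rw [Sym2.eq_swap]
          exact (compat _ _ _ _ hr h2 h3).symm
      · rw [← h2, Sym2.eq_iff] at h1
        rcases h1 with ⟨h2, h3⟩ | ⟨h2, h3⟩
        · exact compat _ _ _ _ hp h2 h3
        · rw [Sym2.eq_swap (a := s')]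
          exact compat _ _ _ _ hp h2 h3
      · have := Sym2.map.injective κ_inj (a₁ := s(p, p')) (a₂ := s(r, r'))
          (h1.trans h2.symm)
        rw [this])
    refine ⟨C, ?_, fun u w => hC _ _ (Or.inl ⟨u, w, rfl, rfl⟩),
      hC _ _ (Or.inr ⟨v, k true, hvk true, by rw [κ_v, hk']; rfl, hct₂⟩)⟩
    rintro ⟨γ, f, hf⟩
    rcases hside f fun x y hxy => (hf x y hxy).1 with hr | hr
    · exact hc (HasMonoCopy.of_forall_mem_range Sum.inl f hf hr fun s t hst =>
        ⟨(adj_inl s t).mp hst, hC _ _ (Or.inl ⟨s, t, rfl, rfl⟩)⟩)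
    · refine hc₂ (HasMonoCopy.of_forall_mem_range κ f hf hr fun p p' hp => ?_)
      exact ⟨adj_κ _ _ hp, hC _ _ (Or.inr ⟨p, p', adj_κ _ _ hp, rfl, rfl⟩)⟩

/-- The graph `S` transmits information on the colour of `s(a, b)` to the colour of `s(a', b')`,
as expressed by `ρ`; the levels `lev` bound distances from `a` and `b`. -/
structure IsSender {V W : Type} (H : SimpleGraph W) (q : ℕ) (ρ : Fin q → Fin q → Prop)
    (S : SimpleGraph V) (a b a' b' : V) (lev : V → ℕ) : Prop where
  adj : S.Adj a b
  adj' : S.Adj a' b'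
  lev_eq_zero : ∀ u, lev u = 0 ↔ u = a ∨ u = b
  lev_le : ∀ u w, S.Adj u w → lev u ≤ lev w + 1
  rel : ∀ c : Sym2 V → Fin q, ¬ HasMonoCopy S H c → ρ (c s(a, b)) (c s(a', b'))
  realize : ∀ i j, ρ i j → ∃ c : Sym2 V → Fin q, ¬ HasMonoCopy S H c ∧ c s(a, b) = i ∧
    c s(a', b') = j

lemma IsSender.exists_extension {V W : Type} [Finite V] [Fintype W] {H : SimpleGraph W}
    (hH : TwoSeparatorFree H) {q : ℕ} (hq : 0 < q) {ρ ρ' ρ'' : Fin q → Fin q → Prop}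
    (hρ : Realizable H q Bool fun t => ρ (t false) (t true))
    (hcomp : ∀ i j, ρ'' i j ↔ ∃ k, ρ' i k ∧ ρ k j)
    {S : SimpleGraph V} {a b a' b' : V} {lev : V → ℕ} (hS : IsSender H q ρ' S a b a' b' lev)
    {m n : ℕ} (hm : m ≠ 0) (hn : n ≠ 0) (hma : lev a' ≤ m + 1 ∧ m ≤ lev a' + 1)
    (hmb : lev b' ≤ m + 1 ∧ m ≤ lev b' + 1) (hna : lev a' ≤ n + 1 ∧ n ≤ lev a' + 1)
    (hnb : lev b' ≤ n + 1 ∧ n ≤ lev b' + 1) (hmn : m ≤ n + 1 ∧ n ≤ m + 1) :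
    ∃ (V' : Type) (_ : Finite V') (S' : SimpleGraph V') (ι : V ↪ V') (y : V') (lev' : V' → ℕ),
      IsSender H q ρ'' S' (ι a) (ι b) (ι b') y lev' ∧ (∀ u, lev' (ι u) = lev u) ∧ lev' y = n ∧
      ∀ u, u ∉ Set.range ι → u ≠ y → lev' u = m := by
  classical
  obtain ⟨V', _, S', ι, y, hy, hadj, hιadj, hcross, hrel, hreal⟩ :=
    hρ.exists_extension hH hq S hS.adj'
  let lev' : V' → ℕ := fun u => if h : ∃ w, ι w = u then lev h.choose else if u = y then n else m
  have lev_ι : ∀ u, lev' (ι u) = lev u := by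
    intro u
    have h : ∃ w, ι w = ι u := ⟨u, rfl⟩
    simp only [lev', dif_pos h]
    rw [ι.injective h.choose_spec]
  have lev_y : lev' y = n := by
    simp only [lev', dif_neg (show ¬ ∃ w, ι w = y from hy), if_true]
  have lev_o : ∀ u, u ∉ Set.range ι → u ≠ y → lev' u = m := by
    intro u hu huy
    simp only [lev', dif_neg (show ¬ ∃ w, ι w = u from hu), if_neg huy]
  have lev_mn : ∀ u, u ∉ Set.range ι → lev' u = m ∨ lev' u = n := by
    intro u hu
    by_cases huy : u = y
    · rw [huy]; exact Or.inr lev_y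
    · exact Or.inl (lev_o u hu huy)
  refine ⟨V', inferInstance, S', ι, y, lev', ⟨?_, hadj, ?_, ?_, ?_, ?_⟩, lev_ι, lev_y, lev_o⟩
  · exact (hιadj _ _).mpr hS.adj
  · intro u
    by_cases hu : u ∈ Set.range ι
    · obtain ⟨u, rfl⟩ := hu
      rw [lev_ι, hS.lev_eq_zero]
      simp
    · constructor
      · intro h
        rcases lev_mn u hu with h' | h'
        · exact absurd (h'.symm.trans h) hm
        · exact absurd (h'.symm.trans h) hn
      · rintro (rfl | rfl) <;> exact absurd ⟨_, rfl⟩ hu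
  · intro u w huw
    by_cases hu : u ∈ Set.range ι <;> by_cases hw : w ∈ Set.range ι
    · obtain ⟨u, rfl⟩ := hu
      obtain ⟨w, rfl⟩ := hw
      rw [lev_ι, lev_ι]
      exact hS.lev_le _ _ ((hιadj _ _).mp huw)
    · obtain ⟨u, rfl⟩ := hu
      rw [lev_ι]
      rcases hcross w u hw huw.symm with rfl | rfl <;> rcases lev_mn w hw with h | h <;>
        rw [h] <;> omega
    · obtain ⟨w, rfl⟩ := hw
      rw [lev_ι]
      rcases hcross u w hu huw with rfl | rfl <;> rcases lev_mn u hu with h | h <;>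
        rw [h] <;> omega
    · rcases lev_mn u hu with h | h <;> rcases lev_mn w hw with h' | h' <;> rw [h, h'] <;> omega
  · intro c' hc'
    obtain ⟨h1, h2⟩ := hrel c' hc'
    refine (hcomp _ _).mpr ⟨_, hS.rel _ h1, ?_⟩
    rw [Sym2.eq_swap (a := a')]
    exact h2
  · intro i j hij
    obtain ⟨k, hik, hkj⟩ := (hcomp i j).mp hij
    obtain ⟨c, hc, hci, hck⟩ := hS.realize i k hik
    obtain ⟨c', hc', hcc', hj⟩ := hreal c hc j (by rwa [Sym2.eq_swap, hck])
    exact ⟨c', hc', by rw [hcc', hci], hj⟩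

lemma exists_isSender_eq {W : Type} [Fintype W] {H : SimpleGraph W} (hH : TwoSeparatorFree H)
    {q : ℕ} (hq : 2 ≤ q) (i : ℕ) :
    ∃ (V : Type) (_ : Finite V) (S : SimpleGraph V) (a b a' b' : V) (lev : V → ℕ),
      IsSender H q Eq S a b a' b' lev ∧ lev a' = i / 2 ∧ lev b' = (i + 1) / 2 ∧
      ∀ u, lev u ≤ (i + 1) / 2 := by
  induction i with
  | zero =>
    refine ⟨Bool, inferInstance, ⊤, false, true, false, true, fun _ => 0,
      ⟨by simp, by simp, by simp, by simp, fun c _ => rfl, fun i j hij => ?_⟩, rfl, rfl, by simp⟩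
    refine ⟨fun _ => i, ?_, rfl, hij⟩
    rintro ⟨-, f, -⟩
    have := Fintype.card_le_of_embedding f
    rw [Fintype.card_bool] at this
    have := hH.1
    omega
  | succ i ih =>
    obtain ⟨V, _, S, a, b, a', b', lev, hS, ha, hb, hle⟩ := ih
    obtain ⟨V', _, S', ι, y, lev', hS', h1, h2, h3⟩ := hS.exists_extension (ρ := Eq) (ρ'' := Eq)
      hH (by omega) (realizable_eq hH hq) (by simp) (m := i / 2 + 1) (n := i / 2 + 1)
      (by omega) (by omega) (by omega) (by omega) (by omega) (by omega) (by omega)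
    refine ⟨V', inferInstance, S', ι a, ι b, ι b', y, lev', hS', by rw [h1, hb],
      by rw [h2]; omega, fun u => ?_⟩
    by_cases hu : u ∈ Set.range ι
    · obtain ⟨u, rfl⟩ := hu
      rw [h1]
      have := hle u
      omega
    · by_cases huy : u = y
      · rw [huy, h2]; omega
      · rw [h3 u hu huy]; omega

/-- Long negative senders. -/
theorem exists_isSender_ne {W : Type} [Fintype W] {H : SimpleGraph W} (hH : TwoSeparatorFree H)
    {q : ℕ} (hq : 2 ≤ q) {m : ℕ} (hm : m ≠ 0) :
    ∃ (V : Type) (_ : Finite V) (S : SimpleGraph V) (a b a' b' : V) (lev : V → ℕ),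
      IsSender H q Ne S a b a' b' lev ∧ (∀ u, lev u ≤ m + 1) ∧
      ∀ u, lev u = m + 1 ↔ u = a' ∨ u = b' := by
  obtain ⟨V, _, S, a, b, a', b', lev, hS, ha, hb, hle⟩ := exists_isSender_eq hH hq (2 * m)
  obtain ⟨V', _, S', ι, y, lev', hS', h1, h2, h3⟩ := hS.exists_extension (ρ := Ne) (ρ'' := Ne)
    hH (by omega) (realizable_ne hH hq) (by simp) (m := m) (n := m + 1)
    (by omega) (by omega) (by omega) (by omega) (by omega) (by omega) (by omega)
  obtain ⟨V'', _, S'', κ, z, lev'', hS'', h1', h2', h3'⟩ := hS'.exists_extension (ρ := Eq)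
    (ρ'' := Ne) hH (by omega) (realizable_eq hH hq) (by simp) (m := m) (n := m + 1)
    (by omega) (by omega) (by rw [h1]; omega) (by omega) (by rw [h1]; omega) (by omega) (by omega)
  have key : ∀ u, (lev'' u ≤ m ∧ u ≠ κ y ∧ u ≠ z) ∨ (lev'' u = m + 1 ∧ (u = κ y ∨ u = z)) := by
    intro u
    by_cases huz : u = z
    · subst huz
      exact Or.inr ⟨h2', Or.inr rfl⟩
    by_cases hu : u ∈ Set.range κ
    · obtain ⟨u, rfl⟩ := hu
      by_cases huy : u = y
      · subst huy
        exact Or.inr ⟨by rw [h1', h2], Or.inl rfl⟩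
      · refine Or.inl ⟨?_, fun h => huy (κ.injective h), huz⟩
        rw [h1']
        by_cases hu : u ∈ Set.range ι
        · obtain ⟨u, rfl⟩ := hu
          rw [h1]
          have := hle u
          omega
        · rw [h3 u hu huy]
    · exact Or.inl ⟨(h3' u hu huz).le, fun h => hu ⟨_, h.symm⟩, huz⟩
  refine ⟨V'', inferInstance, S'', κ (ι a), κ (ι b), κ y, z, lev'', hS'', fun u => ?_, fun u => ?_⟩
  · rcases key u with h | h <;> omega
  · rcases key u with ⟨h, h', h''⟩ | ⟨h, h'⟩
    · simp only [h', h'', or_self, iff_false]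
      omega
    · simp only [h, h']

/-- The graph `Γ` consists of copies `κ e` of a sender `S`, one for each edge `e` of `F`, such that
`e` is the first edge of the copy `κ e` and all copies share their last edge `s(y₀, y₁)`. -/
structure SenderGluing {VF V U W : Type} (H : SimpleGraph W) (q L : ℕ) (F : SimpleGraph VF)
    (S : SimpleGraph V) (a b a' b' : V) (lev : V → ℕ) (j : VF → U) (κ : F.edgeSet → V → U)
    (y₀ y₁ : U) (Lev : U → ℕ) (Γ : SimpleGraph U) : Prop where
  sender : IsSender H q Ne S a b a' b' lev
  lev_eq : ∀ u, lev u = L ↔ u = a' ∨ u = b'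
  two_le : 2 ≤ L
  j_injective : Function.Injective j
  κ_injective : ∀ e, Function.Injective (κ e)
  ends : ∀ e, ∃ u w, e.1 = s(u, w) ∧ κ e a = j u ∧ κ e b = j w
  map_a' : ∀ e, κ e a' = y₀
  map_b' : ∀ e, κ e b' = y₁
  eq_j : ∀ e p u, κ e p = j u → p = a ∨ p = b
  overlap : ∀ e p e' p', κ e p = κ e' p' → (e = e' ∧ p = p') ∨ (p = p' ∧ (p = a' ∨ p = b')) ∨
    ((p = a ∨ p = b) ∧ (p' = a ∨ p' = b))
  lev_κ : ∀ e p, Lev (κ e p) = lev p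
  lev_j : ∀ u, Lev (j u) = 0
  adj_iff : ∀ u w, Γ.Adj u w ↔ ∃ e p p', S.Adj p p' ∧ κ e p = u ∧ κ e p' = w

namespace SenderGluing

variable {VF V U W : Type} {H : SimpleGraph W} {q L : ℕ} {F : SimpleGraph VF}
    {S : SimpleGraph V} {a b a' b' : V} {lev : V → ℕ} {j : VF → U} {κ : F.edgeSet → V → U}
    {y₀ y₁ : U} {Lev : U → ℕ} {Γ : SimpleGraph U}

lemma adj_κ_of_adj (h : SenderGluing H q L F S a b a' b' lev j κ y₀ y₁ Lev Γ) (e : F.edgeSet)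
    {p p' : V} (hp : S.Adj p p') : Γ.Adj (κ e p) (κ e p') :=
  (h.adj_iff _ _).mpr ⟨e, p, p', hp, rfl, rfl⟩

lemma lev_of_eq (h : SenderGluing H q L F S a b a' b' lev j κ y₀ y₁ Lev Γ) {p : V}
    (hp : p = a ∨ p = b) : lev p = 0 :=
  (h.sender.lev_eq_zero p).mpr hp

lemma not_adj (h : SenderGluing H q L F S a b a' b' lev j κ y₀ y₁ Lev Γ) {p p' : V}
    (hp : p = a ∨ p = b) (hp' : p' = a' ∨ p' = b') : ¬ S.Adj p p' := by
  intro hadj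
  have h1 := h.lev_of_eq hp
  have h2 := (h.lev_eq p').mpr hp'
  have h3 := h.sender.lev_le _ _ hadj.symm
  have h4 := h.two_le
  omega

lemma mem_range_j (h : SenderGluing H q L F S a b a' b' lev j κ y₀ y₁ Lev Γ) (e : F.edgeSet)
    {p : V} (hp : p = a ∨ p = b) : κ e p ∈ Set.range j := by
  obtain ⟨u, w, -, hu, hw⟩ := h.ends e
  rcases hp with rfl | rfl
  · exact ⟨u, hu.symm⟩
  · exact ⟨w, hw.symm⟩

lemma map_edge (h : SenderGluing H q L F S a b a' b' lev j κ y₀ y₁ Lev Γ) (e : F.edgeSet) :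
    s(κ e a, κ e b) = e.1.map j := by
  obtain ⟨u, w, he, hu, hw⟩ := h.ends e
  rw [he, hu, hw]
  rfl

lemma eq_edge (h : SenderGluing H q L F S a b a' b' lev j κ y₀ y₁ Lev Γ) {p p' : V}
    (hp : p = a ∨ p = b) (hp' : p' = a ∨ p' = b) (hne : p ≠ p') : s(p, p') = s(a, b) := by
  rcases hp with rfl | rfl <;> rcases hp' with rfl | rfl
  · exact absurd rfl hne
  · rfl
  · exact Sym2.eq_swap
  · exact absurd rfl hne

lemma adj_j (h : SenderGluing H q L F S a b a' b' lev j κ y₀ y₁ Lev Γ) (u w : VF) :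
    Γ.Adj (j u) (j w) ↔ F.Adj u w := by
  rw [h.adj_iff]
  constructor
  · rintro ⟨e, p, p', hp, h1, h2⟩
    have h3 := congrArg (Sym2.map (κ e))
      (h.eq_edge (h.eq_j _ _ _ h1) (h.eq_j _ _ _ h2) hp.ne)
    change s(κ e p, κ e p') = s(κ e a, κ e b) at h3
    rw [h1, h2, h.map_edge] at h3
    have h4 : s(u, w) = e.1 := Sym2.map.injective h.j_injective h3
    rw [← SimpleGraph.mem_edgeSet, h4]
    exact e.2
  · intro huw
    have h1 := h.map_edge ⟨s(u, w), huw⟩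
    change _ = s(j u, j w) at h1
    rcases Sym2.eq_iff.mp h1 with ⟨h2, h3⟩ | ⟨h2, h3⟩
    · exact ⟨_, a, b, h.sender.adj, h2, h3⟩
    · exact ⟨_, b, a, h.sender.adj.symm, h3, h2⟩

lemma adj_κ (h : SenderGluing H q L F S a b a' b' lev j κ y₀ y₁ Lev Γ) (e : F.edgeSet) (p p' : V) :
    Γ.Adj (κ e p) (κ e p') ↔ S.Adj p p' := by
  refine ⟨fun hadj => ?_, h.adj_κ_of_adj e⟩
  obtain ⟨e', r, r', hr, h1, h2⟩ := (h.adj_iff _ _).mp hadj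
  rcases h.overlap _ _ _ _ h1 with ⟨rfl, rfl⟩ | ⟨rfl, h3⟩ | ⟨h3, h4⟩
  · rwa [← h.κ_injective _ h2]
  · rcases h.overlap _ _ _ _ h2 with ⟨rfl, rfl⟩ | ⟨rfl, -⟩ | ⟨h4, -⟩
    · exact hr
    · exact hr
    · exact absurd hr.symm (h.not_adj h4 h3)
  · rcases h.overlap _ _ _ _ h2 with ⟨rfl, rfl⟩ | ⟨rfl, h5⟩ | ⟨h5, h6⟩
    · rwa [← h.κ_injective _ h1]
    · exact absurd hr (h.not_adj h3 h5)
    · have hne : p ≠ p' := fun hpp => hadj.ne (by rw [hpp])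
      rw [← SimpleGraph.mem_edgeSet, h.eq_edge h4 h6 hne]
      exact h.sender.adj

lemma lev_le (h : SenderGluing H q L F S a b a' b' lev j κ y₀ y₁ Lev Γ) {u w : U}
    (huw : Γ.Adj u w) : Lev u ≤ Lev w + 1 := by
  obtain ⟨e, p, p', hp, rfl, rfl⟩ := (h.adj_iff _ _).mp huw
  rw [h.lev_κ, h.lev_κ]
  exact h.sender.lev_le _ _ hp

/-- Every copy of `H` lies in `F` or in one of the senders. -/
lemma forall_mem_range [Fintype W] (hH : TwoSeparatorFree H)
    (h : SenderGluing H q L F S a b a' b' lev j κ y₀ y₁ Lev Γ) (hL : Fintype.card W ≤ L)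
    (f : W ↪ U) (hf : ∀ x y, H.Adj x y → Γ.Adj (f x) (f y)) :
    (∀ x, f x ∈ Set.range j) ∨ ∃ e, ∀ x, f x ∈ Set.range (κ e) := by
  classical
  have hpair : ∀ u w : U, (Finset.univ.filter fun x => f x = u ∨ f x = w).card ≤ 2 := by
    intro u w
    refine (Finset.card_le_card_of_injOn f (t := {u, w}) ?_
      f.injective.injOn).trans Finset.card_le_two
    intro x hx
    simpa using hx
  have hpiece : ∀ x, ∃ e, f x ∈ Set.range (κ e) := by
    intro x
    obtain ⟨y, hxy, -⟩ := hH.exists_adj_ne x x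
    obtain ⟨e, p, p', -, h1, -⟩ := (h.adj_iff _ _).mp (hf x y hxy)
    exact ⟨e, p, h1⟩
  by_cases hL' : ∀ x, Lev (f x) ≠ L
  · by_cases hj : ∀ x, f x ∈ Set.range j
    · exact Or.inl hj
    right
    push Not at hj
    obtain ⟨x₀, hx₀⟩ := hj
    obtain ⟨e, he⟩ := hpiece x₀
    refine ⟨e, fun x => ?_⟩
    by_cases hx : f x = κ e a ∨ f x = κ e b
    · rcases hx with hx | hx
      · exact ⟨a, hx.symm⟩
      · exact ⟨b, hx.symm⟩
    refine (hH.propagate (hpair (κ e a) (κ e b))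
      (A := fun x => f x ∈ Set.range (κ e) ∧ f x ∉ Set.range j) ?_ (a := x₀) ?_ ⟨he, hx₀⟩ x
      (by simpa using hx)).1
    · rintro x y - hy hxy ⟨⟨p, hp⟩, hxj⟩
      obtain ⟨e', r, r', hr, h1, h2⟩ := (h.adj_iff _ _).mp (hf x y hxy)
      rcases h.overlap _ _ _ _ (hp.trans h1.symm) with ⟨rfl, rfl⟩ | ⟨-, h3⟩ | ⟨h3, -⟩
      · refine ⟨⟨r', h2⟩, ?_⟩
        rintro ⟨u, hu⟩
        refine hy (Finset.mem_filter.mpr ⟨Finset.mem_univ _, ?_⟩)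
        rcases h.eq_j _ _ _ (h2.trans hu.symm) with rfl | rfl
        · exact Or.inl h2.symm
        · exact Or.inr h2.symm
      · exact absurd (by rw [← hp, h.lev_κ]; exact (h.lev_eq p).mpr h3) (hL' x)
      · exact absurd (hp ▸ h.mem_range_j e h3) hxj
    · simp only [Finset.mem_filter, Finset.mem_univ, true_and]
      rintro (hx | hx)
      · exact hx₀ (hx ▸ h.mem_range_j e (Or.inl rfl))
      · exact hx₀ (hx ▸ h.mem_range_j e (Or.inr rfl))
  · push Not at hL'
    obtain ⟨z, hz⟩ := hL'
    have hwalk : ∀ {x y : W} (w : H.Walk x y), Lev (f x) ≤ Lev (f y) + w.length := by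
      intro x y w
      induction w with
      | nil => simp
      | cons hadj _ ih =>
        have := h.lev_le (hf _ _ hadj)
        rw [SimpleGraph.Walk.length_cons]
        omega
    have h0 : ∀ x, f x ∉ Set.range j := by
      rintro x ⟨u, hu⟩
      obtain ⟨w, hw⟩ := hH.connected z x
      have := hwalk w
      rw [← hu, h.lev_j] at this
      omega
    right
    obtain ⟨x₀, hx₀⟩ : ∃ x, x ∉ Finset.univ.filter fun x => f x = y₀ ∨ f x = y₁ := by
      by_contra hcon
      push Not at hcon
      have h1 := hpair y₀ y₁
      rw [Finset.eq_univ_iff_forall.mpr hcon, Finset.card_univ] at h1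
      have := hH.1
      omega
    obtain ⟨e, he⟩ := hpiece x₀
    refine ⟨e, fun x => ?_⟩
    by_cases hx : f x = y₀ ∨ f x = y₁
    · rcases hx with hx | hx
      · exact ⟨a', by rw [hx, h.map_a']⟩
      · exact ⟨b', by rw [hx, h.map_b']⟩
    refine hH.propagate (hpair y₀ y₁) (A := fun x => f x ∈ Set.range (κ e)) ?_ hx₀ he x
      (by simpa using hx)
    rintro x y hx - hxy ⟨p, hp⟩
    obtain ⟨e', r, r', hr, h1, h2⟩ := (h.adj_iff _ _).mp (hf x y hxy)
    rcases h.overlap _ _ _ _ (hp.trans h1.symm) with ⟨rfl, rfl⟩ | ⟨-, h3⟩ | ⟨h3, -⟩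
    · exact ⟨r', h2⟩
    · refine absurd (Finset.mem_filter.mpr ⟨Finset.mem_univ _, ?_⟩) hx
      rcases h3 with rfl | rfl
      · exact Or.inl (by rw [← hp, h.map_a'])
      · exact Or.inr (by rw [← hp, h.map_b'])
    · exact absurd (hp ▸ h.mem_range_j e h3) (h0 x)

/-- Colourings of `F` and of the senders which fit together. -/
lemma exists_colouring (hq : 0 < q) (h : SenderGluing H q L F S a b a' b' lev j κ y₀ y₁ Lev Γ)
    (cF : Sym2 VF → Fin q) (c : F.edgeSet → Sym2 V → Fin q) (γ : Fin q)
    (hab : ∀ e, c e s(a, b) = cF e.1) (hγ : ∀ e, c e s(a', b') = γ) :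
    ∃ C : Sym2 U → Fin q, (∀ u w, F.Adj u w → C s(j u, j w) = cF s(u, w)) ∧
      ∀ e p p', S.Adj p p' → C s(κ e p, κ e p') = c e s(p, p') := by
  have : Nonempty (Fin q) := ⟨⟨0, hq⟩⟩
  have compat : ∀ e p p' e' r r', S.Adj p p' → S.Adj r r' → κ e p = κ e' r → κ e p' = κ e' r' →
      c e s(p, p') = c e' s(r, r') := by
    intro e p p' e' r r' hp hr h1 h2
    by_cases hee : e = e'
    · subst hee
      rw [h.κ_injective _ h1, h.κ_injective _ h2]
    rcases h.overlap _ _ _ _ h1 with ⟨h3, -⟩ | ⟨rfl, h3⟩ | ⟨h3, h4⟩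
    · exact absurd h3 hee
    · rcases h.overlap _ _ _ _ h2 with ⟨h4, -⟩ | ⟨rfl, h4⟩ | ⟨h4, -⟩
      · exact absurd h4 hee
      · have hs : s(p, p') = s(a', b') := by
          rcases h3 with rfl | rfl <;> rcases h4 with rfl | rfl
          · exact absurd hp S.irrefl
          · rfl
          · exact Sym2.eq_swap
          · exact absurd hp S.irrefl
        rw [hs, hγ, hγ]
      · exact absurd hp.symm (h.not_adj h4 h3)
    · rcases h.overlap _ _ _ _ h2 with ⟨h5, -⟩ | ⟨rfl, h5⟩ | ⟨h5, h6⟩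
      · exact absurd h5 hee
      · exact absurd hp (h.not_adj h3 h5)
      · exfalso
        have h7 := congrArg (Sym2.map (κ e)) (h.eq_edge h3 h5 hp.ne)
        have h8 := congrArg (Sym2.map (κ e')) (h.eq_edge h4 h6 hr.ne)
        change s(κ e p, κ e p') = s(κ e a, κ e b) at h7
        change s(κ e' r, κ e' r') = s(κ e' a, κ e' b) at h8
        rw [h.map_edge] at h7 h8
        rw [h1, h2, h8] at h7
        exact hee (Subtype.ext (Sym2.map.injective h.j_injective h7.symm))
  obtain ⟨C, hC⟩ := exists_forall_eq_of_functional (A := Sym2 U) (B := Fin q)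
    (fun z δ => ∃ e p p', S.Adj p p' ∧ s(κ e p, κ e p') = z ∧ c e s(p, p') = δ) (by
    rintro z δ δ' ⟨e, p, p', hp, h1, rfl⟩ ⟨e', r, r', hr, h2, rfl⟩
    rw [← h2, Sym2.eq_iff] at h1
    rcases h1 with ⟨h1, h2⟩ | ⟨h1, h2⟩
    · exact compat _ _ _ _ _ _ hp hr h1 h2
    · rw [Sym2.eq_swap (a := r)]
      exact compat _ _ _ _ _ _ hp hr.symm h1 h2)
  refine ⟨C, fun u w huw => ?_, fun e p p' hp => hC _ _ ⟨e, p, p', hp, rfl, rfl⟩⟩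
  exact hC _ _ ⟨⟨s(u, w), huw⟩, a, b, h.sender.adj, h.map_edge _, hab _⟩

lemma not_isRamsey [Fintype W] (hH : TwoSeparatorFree H) (hq : 0 < q)
    (h : SenderGluing H q L F S a b a' b' lev j κ y₀ y₁ Lev Γ) (hL : Fintype.card W ≤ L)
    (cF : Sym2 VF → Fin q) (c : F.edgeSet → Sym2 V → Fin q) (γ : Fin q)
    (hab : ∀ e, c e s(a, b) = cF e.1) (hγ : ∀ e, c e s(a', b') = γ) {Γ₀ : SimpleGraph U}
    (hle : Γ₀ ≤ Γ) (hcF : ¬ HasMonoCopy (Γ₀.comap j) H cF)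
    (hc : ∀ e, ¬ HasMonoCopy (Γ₀.comap (κ e)) H (c e)) : ¬ IsRamsey q Γ₀ H := by
  intro hR
  obtain ⟨C, hCF, hCc⟩ := h.exists_colouring hq cF c γ hab hγ
  obtain ⟨i, f, hf⟩ := hR C
  rcases h.forall_mem_range hH hL f fun x y hxy => hle (hf x y hxy).1 with hr | ⟨e, hr⟩
  · exact hcF (HasMonoCopy.of_forall_mem_range j f hf hr fun u w huw =>
      ⟨huw, hCF _ _ ((h.adj_j _ _).mp (hle huw))⟩)
  · exact hc e (HasMonoCopy.of_forall_mem_range (κ e) f hf hr fun u w huw =>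
      ⟨huw, hCc _ _ _ ((h.adj_κ _ _ _).mp (hle huw))⟩)

lemma isRamsey {r : ℕ} (hr : 0 < r)
    (h : SenderGluing H (r + 1) L F S a b a' b' lev j κ y₀ y₁ Lev Γ) (hF : IsRamsey r F H) :
    IsRamsey (r + 1) Γ H := by
  intro c
  by_contra hc
  have hne : ∀ e : F.edgeSet, c (e.1.map j) ≠ c s(y₀, y₁) := by
    intro e
    have := h.sender.rel (fun z => c (z.map (κ e))) fun hm => hc
      (hm.of_embedding ⟨κ e, h.κ_injective e⟩ (fun p p' hp => h.adj_κ_of_adj e hp)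
        fun _ _ _ => rfl)
    change c s(κ e a, κ e b) ≠ c s(κ e a', κ e b') at this
    rwa [h.map_edge, h.map_a', h.map_b'] at this
  have : Nonempty (Fin r) := ⟨⟨0, hr⟩⟩
  obtain ⟨c₀, hc₀⟩ := exists_forall_eq_of_functional (A := Sym2 VF) (B := Fin r)
    (fun z δ => (c s(y₀, y₁)).succAbove δ = c (z.map j))
    (fun z δ δ' h1 h2 => Fin.succAbove_right_injective (h1.trans h2.symm))
  obtain ⟨i, f, hf⟩ := hF c₀
  refine hc ⟨(c s(y₀, y₁)).succAbove i, f.trans ⟨j, h.j_injective⟩, fun x y hxy => ?_⟩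
  obtain ⟨h1, h2⟩ := hf x y hxy
  refine ⟨(h.adj_j _ _).mpr h1, ?_⟩
  obtain ⟨δ, hδ⟩ := Fin.exists_succAbove_eq (hne ⟨s(f x, f y), h1⟩)
  rw [← h2, hc₀ _ _ hδ, hδ]
  rfl

end SenderGluing

lemma IsSender.exists_senderGluing {VF V W : Type} [Finite VF] [Finite V] {H : SimpleGraph W}
    {q L : ℕ} (F : SimpleGraph VF) {S : SimpleGraph V} {a b a' b' : V} {lev : V → ℕ}
    (hS : IsSender H q Ne S a b a' b' lev) (hlev : ∀ u, lev u = L ↔ u = a' ∨ u = b')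
    (hL : 2 ≤ L) :
    ∃ (U : Type) (_ : Finite U) (j : VF → U) (κ : F.edgeSet → V → U) (y₀ y₁ : U) (Lev : U → ℕ)
      (Γ : SimpleGraph U), SenderGluing H q L F S a b a' b' lev j κ y₀ y₁ Lev Γ := by
  classical
  have hsrc : ∀ e : F.edgeSet, ∃ u w, e.1 = s(u, w) ∧ u ≠ w := by
    rintro ⟨e, he⟩
    induction e with
    | _ u w => exact ⟨u, w, rfl, SimpleGraph.Adj.ne he⟩
  choose src tgt hst hne using hsrc
  have lev_a : lev a = 0 := (hS.lev_eq_zero a).mpr (Or.inl rfl)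
  have lev_b : lev b = 0 := (hS.lev_eq_zero b).mpr (Or.inr rfl)
  have lev_a' : lev a' = L := (hlev a').mpr (Or.inl rfl)
  have lev_b' : lev b' = L := (hlev b').mpr (Or.inr rfl)
  have ha'a : a' ≠ a := fun h => by rw [h, lev_a] at lev_a'; omega
  have ha'b : a' ≠ b := fun h => by rw [h, lev_b] at lev_a'; omega
  have hb'a : b' ≠ a := fun h => by rw [h, lev_a] at lev_b'; omega
  have hb'b : b' ≠ b := fun h => by rw [h, lev_b] at lev_b'; omega
  let j : VF → VF ⊕ Bool ⊕ (F.edgeSet × V) := Sum.inl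
  let y : Bool → VF ⊕ Bool ⊕ (F.edgeSet × V) := fun x => Sum.inr (Sum.inl x)
  let κ : F.edgeSet → V → VF ⊕ Bool ⊕ (F.edgeSet × V) := fun e p =>
    if p = a then j (src e) else if p = b then j (tgt e) else if p = a' then y false else
      if p = b' then y true else Sum.inr (Sum.inr (e, p))
  have κ_a : ∀ e, κ e a = j (src e) := fun e => if_pos rfl
  have κ_b : ∀ e, κ e b = j (tgt e) := fun e => by
    simp only [κ, if_neg hS.adj.ne', if_true]
  have κ_a' : ∀ e, κ e a' = y false := fun e => by
    simp only [κ, if_neg ha'a, if_neg ha'b, if_true]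
  have κ_b' : ∀ e, κ e b' = y true := fun e => by
    simp only [κ, if_neg hb'a, if_neg hb'b, if_neg hS.adj'.ne', if_true]
  have cases : ∀ p, p = a ∨ p = b ∨ p = a' ∨ p = b' ∨
      ∀ e, κ e p = Sum.inr (Sum.inr (e, p)) := by
    intro p
    by_cases h1 : p = a
    · exact Or.inl h1
    by_cases h2 : p = b
    · exact Or.inr (Or.inl h2)
    by_cases h3 : p = a'
    · exact Or.inr (Or.inr (Or.inl h3))
    by_cases h4 : p = b'
    · exact Or.inr (Or.inr (Or.inr (Or.inl h4)))
    · refine Or.inr (Or.inr (Or.inr (Or.inr fun e => ?_)))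
      simp only [κ, if_neg h1, if_neg h2, if_neg h3, if_neg h4]
  have overlap : ∀ e p e' p', κ e p = κ e' p' → (e = e' ∧ p = p') ∨
      (p = p' ∧ (p = a' ∨ p = b')) ∨ ((p = a ∨ p = b) ∧ (p' = a ∨ p' = b)) := by
    intro e p e' p' h
    rcases cases p with hp | hp | hp | hp | hp <;>
      rcases cases p' with hp' | hp' | hp' | hp' | hp' <;>
      simp only [hp, hp', κ_a, κ_b, κ_a', κ_b', j, y, Sum.inl.injEq, Sum.inr.injEq,
        Prod.mk.injEq, reduceCtorEq] at h <;>
      first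
      | exact Or.inl h
      | exact Or.inr (Or.inl ⟨hp.trans hp'.symm, Or.inl hp⟩)
      | exact Or.inr (Or.inl ⟨hp.trans hp'.symm, Or.inr hp⟩)
      | exact Or.inr (Or.inr ⟨Or.inl hp, Or.inl hp'⟩)
      | exact Or.inr (Or.inr ⟨Or.inl hp, Or.inr hp'⟩)
      | exact Or.inr (Or.inr ⟨Or.inr hp, Or.inl hp'⟩)
      | exact Or.inr (Or.inr ⟨Or.inr hp, Or.inr hp'⟩)
  have κ_inj : ∀ e, Function.Injective (κ e) := by
    intro e p p' h
    rcases overlap _ _ _ _ h with ⟨-, h1⟩ | ⟨h1, -⟩ | ⟨rfl | rfl, rfl | rfl⟩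
    · exact h1
    · exact h1
    · rfl
    · rw [κ_a, κ_b] at h
      exact absurd (Sum.inl.inj h) (hne e)
    · rw [κ_a, κ_b] at h
      exact absurd (Sum.inl.inj h).symm (hne e)
    · rfl
  refine ⟨_, inferInstance, j, κ, y false, y true,
    Sum.elim (fun _ => 0) (Sum.elim (fun _ => L) fun x => lev x.2),
    { Adj := fun u w => ∃ e p p', S.Adj p p' ∧ κ e p = u ∧ κ e p' = w
      symm := ⟨fun u w ⟨e, p, p', h, h1, h2⟩ => ⟨e, p', p, h.symm, h2, h1⟩⟩
      loopless := ⟨fun u ⟨e, p, p', h, h1, h2⟩ => h.ne (κ_inj e (h1.trans h2.symm))⟩ },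
    { sender := hS
      lev_eq := hlev
      two_le := hL
      j_injective := Sum.inl_injective
      κ_injective := κ_inj
      ends := fun e => ⟨_, _, hst e, κ_a e, κ_b e⟩
      map_a' := κ_a'
      map_b' := κ_b'
      eq_j := ?_
      overlap := overlap
      lev_κ := ?_
      lev_j := fun u => rfl
      adj_iff := fun u w => Iff.rfl }⟩
  · intro e p u h
    rcases cases p with rfl | rfl | rfl | rfl | hp
    · exact Or.inl rfl
    · exact Or.inr rfl
    · rw [κ_a'] at h; cases h
    · rw [κ_b'] at h; cases h
    · rw [hp] at h; cases h
  · intro e p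
    rcases cases p with rfl | rfl | rfl | rfl | hp
    · rw [κ_a, lev_a]; rfl
    · rw [κ_b, lev_b]; rfl
    · rw [κ_a', lev_a']; rfl
    · rw [κ_b', lev_b']; rfl
    · rw [hp]; rfl

lemma IsRamseyMinimal.not_isRamsey_of_lt {V W : Type} {G G' : SimpleGraph V} {H : SimpleGraph W}
    {q : ℕ} (h : IsRamseyMinimal q G H) (hlt : G' < G) : ¬ IsRamsey q G' H := by
  intro hR
  refine h.2 (SimpleGraph.toSubgraph G' hlt.le) ?_ ?_
  · intro htop
    refine hlt.not_ge fun u w huw => ?_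
    have : (SimpleGraph.toSubgraph G' hlt.le).Adj u w := by
      rw [htop]
      exact huw
    exact this
  · exact hR.of_embedding ⟨fun v => ⟨v, trivial⟩, fun u w huw => congrArg Subtype.val huw⟩
      fun _ _ hab => hab

lemma IsRamsey.comap {V V' W : Type} [Fintype W] {H : SimpleGraph W} {q : ℕ}
    {G : SimpleGraph V'} (hG : IsRamsey q G H) (hH : TwoSeparatorFree H) (hq : 0 < q)
    (φ : V ↪ V') (hφ : G.support ⊆ Set.range φ) : IsRamsey q (G.comap φ) H := by
  intro c
  have hinj : Function.Injective (Sym2.map φ) := Sym2.map.injective φ.injective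
  obtain ⟨i, f, hf⟩ := hG (Function.extend (Sym2.map φ) c fun _ => ⟨0, hq⟩)
  refine HasMonoCopy.of_forall_mem_range φ f hf (fun x => ?_) fun a b hab => ⟨hab, ?_⟩
  · obtain ⟨y, hxy, -⟩ := hH.exists_adj_ne x x
    exact hφ ⟨_, (hf x y hxy).1⟩
  · exact hinj.extend_apply c _ s(a, b)

lemma IsRamseyMinimal.exists_adj {V W : Type} [Fintype W] {G : SimpleGraph V} {H : SimpleGraph W}
    (hH : TwoSeparatorFree H) {q : ℕ} (hq : 0 < q) (h : IsRamseyMinimal q G H) (u : V) :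
    ∃ w, G.Adj u w := by
  by_contra hcon
  push Not at hcon
  refine h.2 (SimpleGraph.Subgraph.induce ⊤ {u}ᶜ) ?_ ?_
  · intro htop
    have : u ∈ (SimpleGraph.Subgraph.induce (⊤ : G.Subgraph) {u}ᶜ).verts := by
      rw [htop]
      trivial
    exact this rfl
  · refine IsRamsey.of_embedding (Function.Embedding.refl _) ?_
      (h.1.comap hH hq
        (V := (SimpleGraph.Subgraph.induce (⊤ : G.Subgraph) {u}ᶜ).verts)
        (Function.Embedding.subtype _) ?_)
    · intro a b hab
      exact ⟨a.2, b.2, hab⟩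
    · rintro v ⟨w, hvw⟩
      refine ⟨⟨v, ?_⟩, rfl⟩
      rintro rfl
      exact hcon w hvw

lemma IsRamsey.isRamseyMinimal {V W : Type} {G : SimpleGraph V} {H : SimpleGraph W} {q : ℕ}
    (h : IsRamsey q G H) (hlt : ∀ G' < G, ¬ IsRamsey q G' H) (hadj : ∀ u, ∃ w, G.Adj u w) :
    IsRamseyMinimal q G H := by
  refine ⟨h, fun G' hG' hR => hG' ?_⟩
  have hR' : IsRamsey q G'.spanningCoe H :=
    hR.of_embedding (Function.Embedding.subtype _) fun _ _ hab => hab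
  have heq : G'.spanningCoe = G := by
    by_contra hne
    exact hlt _ (lt_of_le_of_ne G'.spanningCoe_le hne) hR'
  have hG'adj : ∀ u w, G'.Adj u w ↔ G.Adj u w := fun u w =>
    iff_of_eq (congrArg (fun K : SimpleGraph V => K.Adj u w) heq)
  ext u w
  · refine iff_of_true ?_ trivial
    obtain ⟨w, hw⟩ := hadj u
    exact G'.edge_vert ((hG'adj u w).mpr hw)
  · exact hG'adj u w

/-- A Ramsey graph contains a minimal one. -/
lemma IsRamsey.exists_isRamseyMinimal {U W : Type} [Finite U] [Fintype W] {H : SimpleGraph W}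
    (hH : TwoSeparatorFree H) {q : ℕ} (hq : 0 < q) {Γ : SimpleGraph U} (h : IsRamsey q Γ H) :
    ∃ Γ₀ ≤ Γ, IsRamsey q Γ₀ H ∧ ∃ (n : ℕ) (φ : Fin n ↪ U), Set.range φ = Γ₀.support ∧
      IsRamseyMinimal q (Γ₀.comap φ) H := by
  obtain ⟨Γ₀, hle, hΓ₀, hmin⟩ := h.exists_minimal_le
  obtain ⟨n, ⟨e⟩⟩ := Finite.exists_equiv_fin Γ₀.support
  let φ : Fin n ↪ U := e.symm.toEmbedding.trans (Function.Embedding.subtype _)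
  have hφ : Set.range φ = Γ₀.support := by
    ext u
    constructor
    · rintro ⟨i, rfl⟩
      exact (e.symm i).2
    · intro hu
      exact ⟨e ⟨u, hu⟩, congrArg Subtype.val (e.symm_apply_apply _)⟩
  refine ⟨Γ₀, hle, hΓ₀, n, φ, hφ, IsRamsey.isRamseyMinimal
    (hΓ₀.comap hH hq φ hφ.ge) ?_ ?_⟩
  · intro G' hlt hR
    have hmap : G'.map φ ≤ Γ₀ := by
      rw [SimpleGraph.map_le_iff_le_comap]
      exact hlt.le
    refine hmin (G'.map φ) (lt_of_le_of_ne hmap fun heq => ?_)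
      (hR.of_embedding φ fun a b hab => SimpleGraph.map_adj_apply.mpr hab)
    rw [← heq, SimpleGraph.comap_map_eq] at hlt
    exact lt_irrefl _ hlt
  · intro i
    obtain ⟨w, hw⟩ : φ i ∈ Γ₀.support := hφ ▸ ⟨i, rfl⟩
    obtain ⟨k, rfl⟩ : w ∈ Set.range φ := hφ ▸ ⟨_, hw.symm⟩
    exact ⟨k, hw⟩

/-- After deleting an edge, a minimal Ramsey graph can be coloured; giving the deleted edge a new
colour yields a colouring of the whole graph. -/
lemma IsRamseyMinimal.exists_colouring {V W : Type} [Fintype W] {G : SimpleGraph V}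
    {H : SimpleGraph W} (hH : TwoSeparatorFree H) {r : ℕ} (h : IsRamseyMinimal r G H)
    {e : Sym2 V} (he : e ∈ G.edgeSet) :
    (∃ c : Sym2 V → Fin (r + 1), ¬ HasMonoCopy (G.deleteEdges {e}) H c ∧
      ∀ z, c z ≠ Fin.last r) ∧ ∃ c : Sym2 V → Fin (r + 1), ¬ HasMonoCopy G H c := by
  classical
  have hlt : G.deleteEdges {e} < G := by
    refine lt_of_le_of_ne (SimpleGraph.deleteEdges_le _) fun heq => ?_
    rw [← heq, SimpleGraph.edgeSet_deleteEdges] at he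
    exact he.2 rfl
  obtain ⟨c₀, hc₀⟩ := not_forall.mp (h.not_isRamsey_of_lt hlt)
  obtain ⟨x, y, hxy⟩ := hH.exists_adj
  refine ⟨⟨fun z => (c₀ z).castSucc, ?_, fun z => (Fin.castSucc_lt_last _).ne⟩,
    fun z => if z = e then Fin.last r else (c₀ z).castSucc, ?_⟩
  · rintro ⟨i, f, hf⟩
    refine hc₀ ⟨c₀ s(f x, f y), f, fun a b hab => ⟨(hf a b hab).1, ?_⟩⟩
    exact Fin.castSucc_injective r ((hf a b hab).2.trans (hf x y hxy).2.symm)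
  · rintro ⟨i, f, hf⟩
    have hne : ∀ a b, H.Adj a b → s(f a, f b) ≠ e := by
      intro a b hab heq
      obtain ⟨b', hab', hbb'⟩ := hH.exists_adj_ne a b
      have hne' : s(f a, f b') ≠ e := by
        rw [← heq, ne_eq, Sym2.congr_right]
        exact fun h => hbb' (f.injective h)
      have h1 := (hf a b hab).2.trans (hf a b' hab').2.symm
      beta_reduce at h1
      rw [if_pos heq, if_neg hne'] at h1
      exact (Fin.castSucc_lt_last _).ne h1.symm
    refine hc₀ ⟨c₀ s(f x, f y), f, fun a b hab => ⟨?_, ?_⟩⟩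
    · rw [SimpleGraph.deleteEdges_adj]
      exact ⟨(hf a b hab).1, hne a b hab⟩
    · have h1 := (hf a b hab).2.trans (hf x y hxy).2.symm
      beta_reduce at h1
      rw [if_neg (hne a b hab), if_neg (hne x y hxy)] at h1
      exact Fin.castSucc_injective r h1

lemma SenderGluing.adj_of_isRamsey {VF V U W : Type} [Fintype W] {H : SimpleGraph W} {r L : ℕ}
    {F : SimpleGraph VF} {S : SimpleGraph V} {a b a' b' : V} {lev : V → ℕ} {j : VF → U}
    {κ : F.edgeSet → V → U} {y₀ y₁ : U} {Lev : U → ℕ} {Γ : SimpleGraph U}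
    (hH : TwoSeparatorFree H)
    (h : SenderGluing H (r + 1) L F S a b a' b' lev j κ y₀ y₁ Lev Γ) (hL : Fintype.card W ≤ L)
    (hF : IsRamseyMinimal r F H) {Γ₀ : SimpleGraph U} (hle : Γ₀ ≤ Γ)
    (hR : IsRamsey (r + 1) Γ₀ H) {u w : VF} (huw : F.Adj u w) : Γ₀.Adj (j u) (j w) := by
  by_contra hnot
  obtain ⟨⟨cF, hcF, hlast⟩, -⟩ := hF.exists_colouring hH (e := s(u, w)) huw
  choose c hc hab hγ using fun e : F.edgeSet => h.sender.realize (cF e.1) (Fin.last r) (hlast _)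
  refine h.not_isRamsey hH (Nat.succ_pos r) hL cF c (Fin.last r) hab hγ hle
    (fun hm => hcF (hm.of_embedding (Function.Embedding.refl _) (fun x y hxy => ?_)
      fun _ _ _ => rfl))
    (fun e hm => hc e (hm.of_embedding (Function.Embedding.refl _)
      (fun p p' hp => (h.adj_κ e p p').mp (hle hp)) fun _ _ _ => rfl)) hR
  change Γ₀.Adj (j x) (j y) at hxy
  change (F.deleteEdges {s(u, w)}).Adj x y
  rw [SimpleGraph.deleteEdges_adj]
  refine ⟨(h.adj_j x y).mp (hle hxy), fun heq => ?_⟩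
  rcases Sym2.eq_iff.mp heq with ⟨rfl, rfl⟩ | ⟨rfl, rfl⟩
  · exact hnot hxy
  · exact hnot hxy.symm

lemma SenderGluing.exists_lev_eq_of_isRamsey {VF V U W : Type} [Fintype W] {H : SimpleGraph W}
    {r L : ℕ} {F : SimpleGraph VF} {S : SimpleGraph V} {a b a' b' : V} {lev : V → ℕ} {j : VF → U}
    {κ : F.edgeSet → V → U} {y₀ y₁ : U} {Lev : U → ℕ} {Γ : SimpleGraph U}
    (hH : TwoSeparatorFree H) (hr : 0 < r)
    (h : SenderGluing H (r + 1) L F S a b a' b' lev j κ y₀ y₁ Lev Γ) (hL : Fintype.card W ≤ L)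
    (hF : IsRamseyMinimal r F H) {Γ₀ : SimpleGraph U} (hle : Γ₀ ≤ Γ)
    (hR : IsRamsey (r + 1) Γ₀ H) {l : ℕ} (h0 : 0 < l) (hlL : l < L) :
    ∃ u ∈ Γ₀.support, Lev u = l := by
  classical
  by_contra hcon
  push Not at hcon
  obtain ⟨x₀, y₀, hxy₀⟩ := hH.exists_adj
  obtain ⟨e₀, he₀⟩ : ∃ e, e ∈ F.edgeSet := by
    obtain ⟨_, f, hf⟩ := hF.1 fun _ => ⟨0, hr⟩
    exact ⟨s(f x₀, f y₀), (hf x₀ y₀ hxy₀).1⟩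
  obtain ⟨-, cF, hcF⟩ := hF.exists_colouring hH he₀
  have : Nontrivial (Fin (r + 1)) := Fin.nontrivial_iff_two_le.mpr (by omega)
  choose γ hγ using fun i : Fin (r + 1) => exists_ne i
  choose c hc hab _ using fun e : F.edgeSet => h.sender.realize (cF e.1) (γ _) (hγ _).symm
  obtain ⟨c', hc', -, -⟩ := h.sender.realize 0 (γ 0) (hγ 0).symm
  have lev_a : lev a = 0 := h.lev_of_eq (Or.inl rfl)
  have lev_b : lev b = 0 := h.lev_of_eq (Or.inr rfl)
  have lev_a' : lev a' = L := (h.lev_eq a').mpr (Or.inl rfl)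
  refine h.not_isRamsey hH (Nat.succ_pos r) hL cF
    (fun e z => if ∀ p ∈ z, lev p < l then c e z else c' z) (c' s(a', b')) (fun e => ?_)
    (fun e => ?_) hle
    (fun hm => hcF (hm.of_embedding (Function.Embedding.refl _)
      (fun x y hxy => (h.adj_j x y).mp (hle hxy)) fun _ _ _ => rfl)) (fun e => ?_) hR
  · rw [if_pos (by simp [lev_a, lev_b, h0]), hab]
  · rw [if_neg]
    intro hcon
    have := hcon a' (Sym2.mem_mk_left _ _)
    omega
  · rintro ⟨i, f, hf⟩
    have hne : ∀ x, lev (f x) ≠ l := by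
      intro x
      obtain ⟨y, hxy, -⟩ := hH.exists_adj_ne x x
      rw [← h.lev_κ e]
      exact hcon _ ⟨_, (hf x y hxy).1⟩
    have hS : ∀ x y, H.Adj x y → S.Adj (f x) (f y) := fun x y hxy =>
      (h.adj_κ e _ _).mp (hle (hf x y hxy).1)
    by_cases hlow : ∃ x, lev (f x) < l
    · obtain ⟨x, hx⟩ := hlow
      have hall : ∀ y, lev (f y) < l := fun y =>
        hH.propagate (S := ∅) (by simp) (A := fun y => lev (f y) < l)
          (fun y z _ _ hyz hy => by
            have := h.sender.lev_le _ _ (hS y z hyz).symm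
            have := hne z
            omega) (a := x) (by simp) hx y (by simp)
      refine hc e ⟨i, f, fun x y hxy => ⟨hS x y hxy, ?_⟩⟩
      rw [← (hf x y hxy).2]
      beta_reduce
      rw [if_pos]
      intro p hp
      rcases Sym2.mem_iff.mp hp with rfl | rfl
      · exact hall x
      · exact hall y
    · push Not at hlow
      refine hc' ⟨i, f, fun x y hxy => ⟨hS x y hxy, ?_⟩⟩
      rw [← (hf x y hxy).2]
      beta_reduce
      rw [if_neg]
      intro hcon
      exact absurd (hcon _ (Sym2.mem_mk_left _ _)) (hlow x).not_gt

/-- The case of one additional colour. -/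
theorem IsRamseyMinimal.exists_succ {VF W : Type} [Finite VF] [Fintype W] {H : SimpleGraph W}
    (hH : TwoSeparatorFree H) {r : ℕ} (hr : 0 < r) {F : SimpleGraph VF}
    (hF : IsRamseyMinimal r F H) (N : ℕ) :
    ∃ (n : ℕ) (G : SimpleGraph (Fin n)), N < n ∧ IsRamseyMinimal (r + 1) G H ∧
      Nonempty (F ↪g G) := by
  have hW := hH.1
  obtain ⟨V, _, S, a, b, a', b', lev, hS, -, hlev⟩ :=
    exists_isSender_ne hH (q := r + 1) (by omega) (m := Fintype.card W + N) (by omega)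
  obtain ⟨U, _, j, κ, y₀, y₁, Lev, Γ, h⟩ := hS.exists_senderGluing F hlev (by omega)
  obtain ⟨Γ₀, hle, hR, n, φ, hφ, hmin⟩ :=
    (h.isRamsey hr hF.1).exists_isRamseyMinimal hH (Nat.succ_pos r)
  refine ⟨n, Γ₀.comap φ, ?_, hmin, ?_⟩
  · have hlev' : ∀ l : Fin (Fintype.card W + N), ∃ i, Lev (φ i) = l.1 + 1 := by
      intro l
      obtain ⟨u, hu, hul⟩ := h.exists_lev_eq_of_isRamsey hH hr (by omega) hF hle hR
        (l := l.1 + 1) (by omega) (by omega)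
      rw [← hφ] at hu
      obtain ⟨i, rfl⟩ := hu
      exact ⟨i, hul⟩
    choose ψ hψ using hlev'
    have hinj : Function.Injective ψ := by
      intro l l' hll
      have h1 := hψ l
      rw [hll, hψ l'] at h1
      exact Fin.ext (by omega)
    have := Fintype.card_le_of_injective ψ hinj
    rw [Fintype.card_fin, Fintype.card_fin] at this
    omega
  · have hadj : ∀ u w, Γ₀.Adj (j u) (j w) ↔ F.Adj u w := fun u w =>
      ⟨fun h' => (h.adj_j u w).mp (hle h'), h.adj_of_isRamsey hH (by omega) hF hle hR⟩
    have hj : ∀ u, ∃ i, φ i = j u := by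
      intro u
      obtain ⟨w, hw⟩ := hF.exists_adj hH hr u
      have : j u ∈ Set.range φ := hφ ▸ ⟨j w, (hadj u w).mpr hw⟩
      exact this
    choose ψ hψ using hj
    refine ⟨⟨⟨ψ, fun u w huw => h.j_injective (by rw [← hψ, ← hψ, huw])⟩, ?_⟩⟩
    intro u w
    change Γ₀.Adj (φ (ψ u)) (φ (ψ w)) ↔ _
    rw [hψ, hψ, hadj]

/-- If `H` is 3-connected or a triangle and `q > r ≥ 2`, then every
`r`-Ramsey-minimal graph `F` for `H` is an induced subgraph of infinitely many
`q`-Ramsey-minimal graphs for `H`. -/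
theorem stmt0 {VH VF : Type} [Fintype VH] [Fintype VF]
    (H : SimpleGraph VH) (hH : ThreeConnOrK3 H)
    (q r : ℕ) (hr : 2 ≤ r) (hrq : r < q)
    (F : SimpleGraph VF) (hF : IsRamseyMinimal r F H) :
    ∀ N : ℕ, ∃ (n : ℕ) (G : SimpleGraph (Fin n)),
      N < n ∧ IsRamseyMinimal q G H ∧ Nonempty (F ↪g G) := by

  have hH' := hH.twoSeparatorFree
  induction q, hrq using Nat.le_induction with
  | base => exact hF.exists_succ hH' (by omega)
  | succ q hq ih =>
    intro N
    obtain ⟨n, G, -, hG, ⟨φ⟩⟩ := ih 0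
    obtain ⟨n', G', hn', hG', ⟨ψ⟩⟩ := hG.exists_succ hH' (by omega) N
    exact ⟨n', G', hn', hG', ⟨φ.trans ψ⟩⟩
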